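/- The function ρ₁ of the Jost solution expansion can be chosen so that, in addition to the bounds |(u∂_u)^a (ξ∂_ξ)^b ρ₁(u,ξ)| ≤ C_{a,b}(1+u^{−2})(1+u)^{−3}, the following holds: there exist C > 0 and smooth functions γ_j : (0,∞) → ℂ (j ∈ ℕ) with |(u∂_u)^a γ_j(u)| ≤ C_a C^{2j} (1+j)^a for all a ∈ ℕ, such that for every ξ ∈ (0,1] and every u ≥ 2Cξ the series Σ_{j=0}^∞ (−1)^j u^{−2−2j} γ_j(u) ξ^{2j} converges absolutely and equals ρ₁(u,ξ). -/

import Mathlib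

noncomputable section

open MeasureTheory Complex Filter

/-- `h₊(u) = e^{iu}(1 + i/u)`. -/
def hplus (u : ℝ) : ℂ := Complex.exp (Complex.I * u) * (1 + Complex.I / u)

/-- The operator `g ↦ u ∂_u g` acting in the first variable. -/
def DU (F : ℝ → ℝ → ℂ) : ℝ → ℝ → ℂ := fun u ξ => (u : ℂ) * deriv (fun v => F v ξ) u

/-- The operator `g ↦ ξ ∂_ξ g` acting in the second variable. -/
def DXI (F : ℝ → ℝ → ℂ) : ℝ → ℝ → ℂ := fun u ξ => (ξ : ℂ) * deriv (fun η => F u η) ξ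

/-- The operator `g ↦ u ∂_u g` for functions of one variable. -/
def DU1 (g : ℝ → ℂ) : ℝ → ℂ := fun u => (u : ℂ) * deriv g u

open Topology

/-! ### Holomorphic parametric integrals in two complex variables -/

lemma aestronglyMeasurable_fderiv_apply {α : Type*} [MeasurableSpace α] {μ : Measure α}
    {F : ℂ × ℂ → α → ℂ} {U : Set (ℂ × ℂ)} (hU : IsOpen U)
    (hmeas : ∀ p ∈ U, AEStronglyMeasurable (F p) μ)
    (hdiff : ∀ᵐ a ∂μ, DifferentiableOn ℂ (F · a) U) {p : ℂ × ℂ} (hp : p ∈ U) (v : ℂ × ℂ) :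
    AEStronglyMeasurable (fun a => fderiv ℂ (F · a) p v) μ := by
  have hlim : Tendsto (fun n : ℕ => p + ((n : ℂ))⁻¹ • v) atTop (𝓝 p) := by
    have h1 : Tendsto (fun n : ℕ => ((n : ℂ))⁻¹) atTop (𝓝 0) :=
      tendsto_inv_atTop_nhds_zero_nat (𝕜 := ℂ)
    simpa using (h1.smul_const v).const_add p
  obtain ⟨N, hN⟩ := eventually_atTop.1 (hlim.eventually (hU.mem_nhds hp))
  refine aestronglyMeasurable_of_tendsto_ae (u := atTop)
    (f := fun (n : ℕ) a => ((n + N : ℕ) : ℂ) • (F (p + (((n + N : ℕ) : ℂ))⁻¹ • v) a - F p a))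
    (fun n => ((hmeas _ (hN _ (Nat.le_add_left N n))).sub (hmeas p hp)).const_smul ((n + N : ℕ) : ℂ)) ?_
  filter_upwards [hdiff] with a ha
  have hd := (ha.differentiableAt (hU.mem_nhds hp)).hasFDerivAt
  have hc : Tendsto (fun n : ℕ => ‖((n + N : ℕ) : ℂ)‖) atTop atTop := by
    simp only [Complex.norm_natCast]
    exact tendsto_natCast_atTop_atTop.comp (tendsto_add_atTop_nat N)
  exact hd.lim v hc

lemma differentiableOn_integral_param {α : Type*} [MeasurableSpace α] {μ : Measure α}
    {F : ℂ × ℂ → α → ℂ} {U : Set (ℂ × ℂ)} {bound : α → ℝ} (hU : IsOpen U)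
    (hmeas : ∀ p ∈ U, AEStronglyMeasurable (F p) μ)
    (hdiff : ∀ᵐ a ∂μ, DifferentiableOn ℂ (F · a) U)
    (hbound : ∀ᵐ a ∂μ, ∀ p ∈ U, ‖F p a‖ ≤ bound a) (hint : Integrable bound μ) :
    DifferentiableOn ℂ (fun p => ∫ a, F p a ∂μ) U := by
  intro p hp
  refine DifferentiableAt.differentiableWithinAt ?_
  obtain ⟨r, hr, hrU⟩ := Metric.isOpen_iff.1 hU p hp
  have hsub : ∀ q ∈ Metric.ball p (r / 2), Metric.ball q (r / 2) ⊆ U := fun q hq =>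
    (Metric.ball_subset_ball' (by
      have := Metric.mem_ball.1 hq
      linarith)).trans hrU
  have hmem : ∀ q ∈ Metric.ball p (r / 2), q ∈ U := fun q hq =>
    hsub q hq (Metric.mem_ball_self (by positivity))
  have hF' : AEStronglyMeasurable (fun a => fderiv ℂ (F · a) p) μ := by
    have h1 := (aestronglyMeasurable_fderiv_apply hU hmeas hdiff hp (1, 0)).smul_const
      (ContinuousLinearMap.fst ℂ ℂ ℂ)
    have h2 := (aestronglyMeasurable_fderiv_apply hU hmeas hdiff hp (0, 1)).smul_const
      (ContinuousLinearMap.snd ℂ ℂ ℂ)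
    refine (h1.add h2).congr (Eventually.of_forall fun a => ?_)
    ext <;> simp
  refine (hasFDerivAt_integral_of_dominated_of_fderiv_le (𝕜 := ℂ)
    (F' := fun q a => fderiv ℂ (F · a) q) (bound := fun a => 2 * bound a / (r / 2))
    (Metric.ball_mem_nhds p (by positivity : 0 < r / 2))
    ?_ ?_ hF' ?_ ((hint.const_mul 2).div_const _) ?_).differentiableAt
  · filter_upwards [hU.mem_nhds hp] with q hq using hmeas q hq
  · exact hint.mono' (hmeas p hp) (hbound.mono fun a ha => ha p hp)
  · filter_upwards [hdiff, hbound] with a ha hb q hq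
    refine Complex.norm_fderiv_le_div_of_mapsTo_ball (ha.mono (hsub q hq)) ?_ (by positivity)
    intro z hz
    rw [mem_closedBall_iff_norm]
    have h1 := hb z (hsub q hq hz)
    have h2 := hb q (hmem q hq)
    linarith [norm_sub_le (F z a) (F q a)]
  · filter_upwards [hdiff] with a ha q hq
    exact (ha.differentiableAt (hU.mem_nhds (hmem q hq))).hasFDerivAt

/-- The partial derivative in the first variable. -/
def dFst (G : ℂ × ℂ → ℂ) (p : ℂ × ℂ) : ℂ := fderiv ℂ G p (1, 0)

/-- The partial derivative in the second variable. -/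
def dSnd (G : ℂ × ℂ → ℂ) (p : ℂ × ℂ) : ℂ := fderiv ℂ G p (0, 1)

lemma hasDerivAt_line {G : ℂ × ℂ → ℂ} {p v : ℂ × ℂ} {z : ℂ}
    (hG : DifferentiableAt ℂ G (p + z • v)) :
    HasDerivAt (fun w : ℂ => G (p + w • v)) (fderiv ℂ G (p + z • v) v) z := by
  have h1 : HasDerivAt (fun w : ℂ => p + w • v) v z := by
    simpa using ((hasDerivAt_id z).smul_const v).const_add p
  exact hG.hasFDerivAt.comp_hasDerivAt z h1

lemma differentiableOn_fderiv_apply {G : ℂ × ℂ → ℂ} {U : Set (ℂ × ℂ)} (hU : IsOpen U)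
    (hG : DifferentiableOn ℂ G U) (v : ℂ × ℂ) :
    DifferentiableOn ℂ (fun p => fderiv ℂ G p v) U := by
  intro p hp
  refine DifferentiableAt.differentiableWithinAt ?_
  have hUG : {q : ℂ × ℂ | q ∈ U ∧ ‖G q‖ < ‖G p‖ + 1} ∈ 𝓝 p := by
    refine inter_mem (hU.mem_nhds hp) ?_
    exact (hG.continuousOn.continuousAt (hU.mem_nhds hp)).norm.eventually
      (gt_mem_nhds (by linarith))
  obtain ⟨r, hr, hrU⟩ := Metric.mem_nhds_iff.1 hUG
  set ε : ℝ := r / (2 * (‖v‖ + 1)) with hε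
  have hv : 0 < ‖v‖ + 1 := by positivity
  have hε0 : 0 < ε := by positivity
  have hεv : ε * ‖v‖ ≤ r / 2 := by
    have : ε * (‖v‖ + 1) = r / 2 := by rw [hε]; field_simp
    nlinarith
  have hmem : ∀ q ∈ Metric.ball p (r / 2), ∀ z : ℂ, ‖z‖ ≤ ε → q + z • v ∈ Metric.ball p r := by
    intro q hq z hz
    rw [mem_ball_iff_norm] at hq ⊢
    have h1 : ‖z • v‖ ≤ r / 2 := by
      rw [norm_smul]
      exact (mul_le_mul_of_nonneg_right hz (norm_nonneg v)).trans hεv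
    have h2 : q + z • v - p = (q - p) + z • v := by abel
    rw [h2]
    linarith [norm_add_le (q - p) (z • v)]
  have hmemU : ∀ q ∈ Metric.ball p (r / 2), ∀ z : ℂ, ‖z‖ ≤ ε → q + z • v ∈ U :=
    fun q hq z hz => (hrU (hmem q hq z hz)).1
  set Φ : ℂ × ℂ → ℝ → ℂ := fun q θ =>
    (deriv (circleMap 0 ε) θ * ((circleMap 0 ε θ) ^ 2)⁻¹) * G (q + circleMap 0 ε θ • v) with hΦ
  have hcm : ∀ θ, ‖circleMap 0 ε θ‖ = ε := fun θ => by simp [abs_of_pos hε0]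
  have hcoef : ∀ θ, ‖deriv (circleMap 0 ε) θ * ((circleMap 0 ε θ) ^ 2)⁻¹‖ = ε⁻¹ := fun θ => by
    rw [deriv_circleMap]
    simp [abs_of_pos hε0]
    field_simp
  have hne : ∀ θ, circleMap 0 ε θ ≠ 0 := fun θ => by
    rw [← norm_pos_iff, hcm]; exact hε0
  have hccoef : Continuous fun θ => deriv (circleMap 0 ε) θ * ((circleMap 0 ε θ) ^ 2)⁻¹ := by
    simp only [deriv_circleMap]
    exact ((continuous_circleMap 0 ε).mul continuous_const).mul
      (((continuous_circleMap 0 ε).pow 2).inv₀ fun θ => pow_ne_zero 2 (hne θ))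
  have key : DifferentiableOn ℂ
      (fun q => ∫ θ in Set.Ioc 0 (2 * Real.pi), Φ q θ) (Metric.ball p (r / 2)) := by
    refine differentiableOn_integral_param (bound := fun _ => ε⁻¹ * (‖G p‖ + 1))
      Metric.isOpen_ball ?_ ?_ ?_ ?_
    · intro q hq
      refine Continuous.aestronglyMeasurable ?_
      refine hccoef.mul (continuous_iff_continuousAt.2 fun θ => ?_)
      have h1 := (hG.differentiableAt (hU.mem_nhds (hmemU q hq _ (hcm θ).le))).continuousAt
      exact ContinuousAt.comp (f := fun θ => q + circleMap 0 ε θ • v) h1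
        (continuousAt_const.add ((continuous_circleMap 0 ε).continuousAt.smul continuousAt_const))
    · refine Eventually.of_forall fun θ q hq => ?_
      refine DifferentiableAt.differentiableWithinAt ?_
      refine DifferentiableAt.const_mul ?_ _
      have h1 := hG.differentiableAt (hU.mem_nhds (hmemU q hq _ (hcm θ).le))
      exact DifferentiableAt.comp (f := fun q : ℂ × ℂ => q + circleMap 0 ε θ • v) q h1
        (by fun_prop)
    · refine Eventually.of_forall fun θ q hq => ?_
      rw [hΦ]
      simp only
      rw [norm_mul, hcoef]
      exact mul_le_mul_of_nonneg_left (hrU (hmem q hq _ (hcm θ).le)).2.le (by positivity)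
    · exact integrable_const _
  have hformula : ∀ q ∈ Metric.ball p (r / 2), fderiv ℂ G q v =
      (2 * Real.pi * I : ℂ)⁻¹ * ∫ θ in Set.Ioc 0 (2 * Real.pi), Φ q θ := by
    intro q hq
    have hV : IsOpen {z : ℂ | q + z • v ∈ U} := hU.preimage (by fun_prop)
    have h := two_pi_I_inv_smul_circleIntegral_sub_sq_inv_smul_of_differentiable (E := ℂ)
      (U := {z : ℂ | q + z • v ∈ U}) hV (c := 0) (w₀ := 0) (R := ε)
      (f := fun z => G (q + z • v))
      (fun z hz => hmemU q hq z (by simpa using hz))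
      (fun z hz => (hasDerivAt_line (hG.differentiableAt
        (hU.mem_nhds hz))).differentiableAt.differentiableWithinAt)
      (Metric.mem_ball_self hε0)
    have h0 : q + (0 : ℂ) • v ∈ U := hmemU q hq 0 (by simpa using hε0.le)
    rw [(hasDerivAt_line (hG.differentiableAt (hU.mem_nhds h0))).deriv] at h
    simp only [zero_smul, add_zero, sub_zero] at h
    rw [← h, circleIntegral, intervalIntegral.integral_of_le (by positivity)]
    simp only [smul_eq_mul, hΦ, mul_assoc]
  have hnear : (fun q => fderiv ℂ G q v) =ᶠ[𝓝 p] fun q =>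
      (2 * Real.pi * I : ℂ)⁻¹ * ∫ θ in Set.Ioc 0 (2 * Real.pi), Φ q θ := by
    filter_upwards [Metric.ball_mem_nhds p (by positivity : 0 < r / 2)] with q hq
      using hformula q hq
  exact (((key.differentiableAt (Metric.ball_mem_nhds p (by positivity))).const_mul _)).congr_of_eventuallyEq
    hnear

lemma differentiableOn_dFst {G : ℂ × ℂ → ℂ} {U : Set (ℂ × ℂ)} (hU : IsOpen U)
    (hG : DifferentiableOn ℂ G U) : DifferentiableOn ℂ (dFst G) U :=
  differentiableOn_fderiv_apply hU hG (1, 0)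

lemma differentiableOn_dSnd {G : ℂ × ℂ → ℂ} {U : Set (ℂ × ℂ)} (hU : IsOpen U)
    (hG : DifferentiableOn ℂ G U) : DifferentiableOn ℂ (dSnd G) U :=
  differentiableOn_fderiv_apply hU hG (0, 1)

lemma contDiffOn_nat_of_differentiableOn {G : ℂ × ℂ → ℂ} {U : Set (ℂ × ℂ)} (hU : IsOpen U)
    (hG : DifferentiableOn ℂ G U) (n : ℕ) : ContDiffOn ℂ n G U := by
  induction n generalizing G with
  | zero => exact contDiffOn_zero.2 hG.continuousOn
  | succ n ih =>
    push_cast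
    rw [contDiffOn_succ_iff_fderiv_of_isOpen hU]
    refine ⟨hG, by simp, ?_⟩
    have h1 := (ih (differentiableOn_dFst hU hG)).smul
      (contDiffOn_const (c := ContinuousLinearMap.fst ℂ ℂ ℂ))
    have h2 := (ih (differentiableOn_dSnd hU hG)).smul
      (contDiffOn_const (c := ContinuousLinearMap.snd ℂ ℂ ℂ))
    refine (h1.add h2).congr fun p _ => ?_
    ext <;> simp [dFst, dSnd]

/-! ### The Volterra kernel -/

lemma abs_sin_sub_mul_cos_le {t A : ℝ} (ht : 0 ≤ t) (htA : t ≤ A) :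
    |Real.sin t - t * Real.cos t| ≤ 2 * A * (min 1 A) ^ 2 := by
  have hA : 0 ≤ A := ht.trans htA
  have h1 : |Real.sin t - t * Real.cos t| ≤ 2 * t := by
    have hs : |Real.sin t| ≤ t := by
      simpa [abs_of_nonneg ht] using Real.abs_sin_le_abs (x := t)
    have hc : |t * Real.cos t| ≤ t := by
      rw [abs_mul, abs_of_nonneg ht]
      exact mul_le_of_le_one_right ht (Real.abs_cos_le_one t)
    linarith [abs_sub (Real.sin t) (t * Real.cos t)]
  rcases le_total 1 A with h | h
  · rw [min_eq_left h]; linarith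
  · rw [min_eq_right h]
    have h2 : |Real.sin t - t * Real.cos t| ≤ t ^ 3 := by
      rcases ht.eq_or_lt with rfl | ht0
      · simp
      · have e1 := Real.sin_gt_sub_cube ht0
        have e2 := Real.sin_le ht
        have e3 := mul_le_mul_of_nonneg_left (Real.one_sub_sq_div_two_le_cos (x := t)) ht
        have e4 := mul_le_mul_of_nonneg_left (Real.cos_le_one t) ht
        have e5 : 0 < t ^ 3 := by positivity
        rw [abs_le]
        constructor <;> nlinarith
    have h3 : t ^ 3 ≤ A ^ 3 := pow_le_pow_left₀ ht htA 3
    have h4 : 0 ≤ A ^ 3 := by positivity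
    nlinarith

/-- A complex neighbourhood of `{(u, ξ²) : u ≥ ξ > 0} ∪ {(u, ζ) : |ζ| ≤ |u|² / 16}` on which the
Jost solution is holomorphic. -/
def jostDomain : Set (ℂ × ℂ) :=
  {p | |p.1.im| < p.1.re / 2 ∧ -(p.1.re ^ 2 / 4) < p.2.re ∧ ‖p.2‖ < 4 * p.1.re ^ 2}

lemma isOpen_jostDomain : IsOpen jostDomain := by
  have h1 : IsOpen {p : ℂ × ℂ | |p.1.im| < p.1.re / 2} := isOpen_lt (by fun_prop) (by fun_prop)
  have h2 : IsOpen {p : ℂ × ℂ | -(p.1.re ^ 2 / 4) < p.2.re} :=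
    isOpen_lt (by fun_prop) (by fun_prop)
  have h3 : IsOpen {p : ℂ × ℂ | ‖p.2‖ < 4 * p.1.re ^ 2} := isOpen_lt (by fun_prop) (by fun_prop)
  exact h1.inter (h2.inter h3)

lemma jostDomain_re_pos {p : ℂ × ℂ} (hp : p ∈ jostDomain) : 0 < p.1.re := by
  have := hp.1
  have := abs_nonneg p.1.im
  linarith

lemma jostDomain_shift {p : ℂ × ℂ} (hp : p ∈ jostDomain) {t : ℝ} (ht : 0 ≤ t) :
    (p.1 + t, p.2) ∈ jostDomain := by
  have h0 := jostDomain_re_pos hp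
  obtain ⟨h1, h2, h3⟩ := hp
  refine ⟨?_, ?_, ?_⟩
  · simp only [add_im, ofReal_im, add_zero, add_re, ofReal_re]
    linarith
  · simp only [add_re, ofReal_re]
    nlinarith
  · simp only [add_re, ofReal_re]
    nlinarith

lemma norm_le_of_abs_im_lt {u : ℂ} (h : |u.im| < u.re / 2) : ‖u‖ ≤ 3 / 2 * u.re := by
  have := abs_nonneg u.im
  have h1 := norm_le_abs_re_add_abs_im u
  rw [abs_of_pos (by linarith : 0 < u.re)] at h1
  linarith

lemma half_le_norm_add_I {u : ℂ} (h : |u.im| < u.re / 2) :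
    1 / 2 ≤ ‖u + I‖ ∧ ‖u‖ / 2 ≤ ‖u + I‖ := by
  obtain ⟨h1, h2⟩ := abs_lt.1 h
  have e : ‖u + I‖ ^ 2 = u.re ^ 2 + (u.im + 1) ^ 2 := by
    rw [Complex.sq_norm, normSq_apply]; simp; ring
  have e' : ‖u‖ ^ 2 = u.re ^ 2 + u.im ^ 2 := by
    rw [Complex.sq_norm, normSq_apply]; ring
  have h3 : 4 * u.im ^ 2 ≤ u.re ^ 2 := by nlinarith
  constructor
  · refine le_of_sq_le_sq ?_ (norm_nonneg _)
    nlinarith [sq_nonneg (5 * u.im + 1)]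
  · refine le_of_sq_le_sq ?_ (norm_nonneg _)
    rw [div_pow, e, e']
    nlinarith [sq_nonneg (2 * u.im + 1)]

/-- The kernel `h(v)² ∫_u^v h⁻²`, `v = u + t`, in closed form. -/
def jostKernel (u : ℂ) (t : ℝ) : ℂ :=
  exp (I * t) * ((u + t + I) / (u + I)) *
    (((1 + u * (u + t)) * Real.sin t - t * Real.cos t : ℂ) / (u + t) ^ 2)

lemma norm_jostKernel_le {u : ℂ} (h : |u.im| < u.re / 2) {t : ℝ} (ht : 0 ≤ t) :
    ‖jostKernel u t‖ ≤ 14 * min 1 (u.re + t) := by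
  have hu0 : 0 < u.re := by linarith [abs_nonneg u.im]
  set A := u.re + t with hA
  have hA0 : 0 < A := by positivity
  have hv : |(u + t : ℂ).im| < (u + t : ℂ).re / 2 := by
    simp only [add_im, ofReal_im, add_zero, add_re, ofReal_re]; linarith
  have hVre : (u + t : ℂ).re = A := by simp [hA]
  set V := ‖(u + t : ℂ)‖ with hV
  set W := ‖u + I‖ with hW
  set m := min 1 A with hm
  have hm0 : 0 < m := by rw [hm]; positivity
  have hm1 : m ≤ 1 := min_le_left _ _
  have hmA : m ≤ A := min_le_right _ _
  have hAV : A ≤ V := by rw [← hVre]; exact re_le_norm _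
  have hU := norm_le_of_abs_im_lt h
  obtain ⟨hW1, hW2⟩ := half_le_norm_add_I h
  have hS : |Real.sin t| ≤ m := by
    refine le_min (Real.abs_sin_le_one t) ?_
    have := Real.abs_sin_le_abs (x := t)
    rw [abs_of_nonneg ht] at this
    linarith
  have hR := abs_sin_sub_mul_cos_le ht (by linarith : t ≤ A)
  rw [← hm] at hR
  have hUmW : ‖u‖ ≤ 3 * m * W := by
    rcases le_total 1 A with h | h
    · rw [hm, min_eq_left h]; linarith [norm_nonneg u]
    · rw [hm, min_eq_right h]
      nlinarith
  have hvI : ‖(u + t + I : ℂ)‖ ≤ V + 1 := by simpa using norm_add_le (u + t : ℂ) I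
  have hbr : ‖((1 + u * (u + t)) * Real.sin t - t * Real.cos t : ℂ)‖
      ≤ ‖u‖ * V * m + 2 * A * m ^ 2 := by
    have e : ((1 + u * (u + t)) * Real.sin t - t * Real.cos t : ℂ)
        = u * (u + t) * Real.sin t + ((Real.sin t - t * Real.cos t : ℝ) : ℂ) := by
      push_cast; ring
    rw [e]
    refine (norm_add_le _ _).trans (add_le_add ?_ ?_)
    · rw [norm_mul, norm_mul, norm_real, Real.norm_eq_abs]
      gcongr
    · rwa [norm_real, Real.norm_eq_abs]
  have hexp : ‖exp (I * t)‖ = 1 := by rw [mul_comm]; exact norm_exp_ofReal_mul_I t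
  have hV0 : 0 < V := hA0.trans_le hAV
  have hW0 : 0 < W := by linarith
  rw [jostKernel, norm_mul, norm_mul, hexp, norm_div, norm_div, norm_pow, one_mul, div_mul_div_comm,
    div_le_iff₀ (by positivity)]
  have hVm : m * (V + 1) ≤ 2 * V := by nlinarith
  calc ‖(u + t + I : ℂ)‖ * ‖((1 + u * (u + t)) * Real.sin t - t * Real.cos t : ℂ)‖
      ≤ (V + 1) * (‖u‖ * V * m + 2 * A * m ^ 2) := by gcongr
    _ = (m * (V + 1)) * (‖u‖ * V) + (m * (V + 1)) * (2 * A * m) := by ring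
    _ ≤ (2 * V) * ((3 * m * W) * V) + (2 * V) * (2 * V * m) := by gcongr
    _ ≤ 14 * m * (W * V ^ 2) := by
      have : 0 ≤ m * V ^ 2 := by positivity
      nlinarith

/-- The integral kernel in the equation for `ρ`, as a function of `(u, ζ)` and `t`. -/
def rhoKernel (p : ℂ × ℂ) (t : ℝ) : ℂ :=
  -2 * jostKernel p.1 t / ((p.1 + t) ^ 2 * ((p.1 + t) ^ 2 + p.2))

lemma half_re_sq_le_norm {p : ℂ × ℂ} (hp : p ∈ jostDomain) :
    p.1.re ^ 2 / 2 ≤ ‖p.1 ^ 2 + p.2‖ := by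
  have h0 := jostDomain_re_pos hp
  obtain ⟨h1, h2, -⟩ := hp
  obtain ⟨h3, h4⟩ := abs_lt.1 h1
  refine le_trans ?_ (re_le_norm _)
  have : (p.1 ^ 2 + p.2).re = p.1.re ^ 2 - p.1.im ^ 2 + p.2.re := by
    simp [pow_two]
  rw [this]
  nlinarith

lemma jostDomain_ne {p : ℂ × ℂ} (hp : p ∈ jostDomain) :
    p.1 ≠ 0 ∧ p.1 + I ≠ 0 ∧ p.1 ^ 2 + p.2 ≠ 0 := by
  have h0 := jostDomain_re_pos hp
  refine ⟨fun h => ?_, fun h => ?_, fun h => ?_⟩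
  · simp [h] at h0
  · have := (half_le_norm_add_I hp.1).1
    rw [h, norm_zero] at this
    linarith
  · have := half_re_sq_le_norm hp
    rw [h, norm_zero] at this
    nlinarith

lemma norm_rhoKernel_le {p : ℂ × ℂ} (hp : p ∈ jostDomain) {t : ℝ} (ht : 0 ≤ t) :
    ‖rhoKernel p t‖ ≤ 56 * min 1 (p.1.re + t) * ((p.1.re + t) ^ 4)⁻¹ := by
  have h0 := jostDomain_re_pos hp
  have hA0 : 0 < p.1.re + t := by positivity
  have hps := jostDomain_shift hp ht
  have h1 := half_re_sq_le_norm hps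
  have hk := norm_jostKernel_le hp.1 ht
  have hV : p.1.re + t ≤ ‖p.1 + t‖ := by
    have := re_le_norm (p.1 + t)
    simpa using this
  simp only [add_re, ofReal_re] at h1
  have hm0 : 0 < min 1 (p.1.re + t) := by positivity
  rw [rhoKernel, norm_div, norm_mul, norm_mul, norm_pow, ← div_eq_mul_inv]
  have hden : (p.1.re + t) ^ 4 / 2 ≤ ‖p.1 + t‖ ^ 2 * ‖(p.1 + t) ^ 2 + p.2‖ :=
    calc (p.1.re + t) ^ 4 / 2 = (p.1.re + t) ^ 2 * ((p.1.re + t) ^ 2 / 2) := by ring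
      _ ≤ _ := by gcongr
  calc ‖(-2 : ℂ)‖ * ‖jostKernel p.1 t‖ / (‖p.1 + t‖ ^ 2 * ‖(p.1 + t) ^ 2 + p.2‖)
      ≤ 2 * (14 * min 1 (p.1.re + t)) / ((p.1.re + t) ^ 4 / 2) := by
        have : ‖(-2 : ℂ)‖ = 2 := by simp
        rw [this]
        gcongr
    _ = _ := by field_simp; ring

lemma norm_rhoKernel_le_cube {p : ℂ × ℂ} (hp : p ∈ jostDomain) {t : ℝ} (ht : 0 ≤ t) :
    ‖rhoKernel p t‖ ≤ 56 * ((p.1.re + t) ^ 3)⁻¹ := by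
  have h0 := jostDomain_re_pos hp
  have hA0 : 0 < p.1.re + t := by positivity
  refine (norm_rhoKernel_le hp ht).trans ?_
  calc 56 * min 1 (p.1.re + t) * ((p.1.re + t) ^ 4)⁻¹
      ≤ 56 * (p.1.re + t) * ((p.1.re + t) ^ 4)⁻¹ := by
        gcongr; exact min_le_right _ _
    _ = _ := by field_simp

lemma continuousOn_rhoKernel {p : ℂ × ℂ} (hp : p ∈ jostDomain) :
    ContinuousOn (rhoKernel p) (Set.Ici 0) := by
  unfold rhoKernel jostKernel
  have h1 := (jostDomain_ne hp).2.1
  have h2 : ∀ t ∈ Set.Ici (0 : ℝ), (p.1 + t) ≠ 0 := fun t ht =>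
    (jostDomain_ne (jostDomain_shift hp ht)).1
  have h3 : ∀ t ∈ Set.Ici (0 : ℝ), (p.1 + t) ^ 2 + p.2 ≠ 0 := fun t ht =>
    (jostDomain_ne (jostDomain_shift hp ht)).2.2
  refine ContinuousOn.div ?_ (by fun_prop) fun t ht =>
    mul_ne_zero (pow_ne_zero 2 (h2 t ht)) (h3 t ht)
  refine continuousOn_const.mul (ContinuousOn.mul (by fun_prop) ?_)
  exact ContinuousOn.div (by fun_prop) (by fun_prop) fun t ht => pow_ne_zero 2 (h2 t ht)

lemma differentiableOn_rhoKernel {t : ℝ} (ht : 0 ≤ t) :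
    DifferentiableOn ℂ (fun p => rhoKernel p t) jostDomain := by
  unfold rhoKernel jostKernel
  have h1 : ∀ p ∈ jostDomain, p.1 + I ≠ 0 := fun p hp => (jostDomain_ne hp).2.1
  have h2 : ∀ p ∈ jostDomain, p.1 + t ≠ 0 := fun p hp =>
    (jostDomain_ne (jostDomain_shift hp ht)).1
  have h3 : ∀ p ∈ jostDomain, (p.1 + t) ^ 2 + p.2 ≠ 0 := fun p hp =>
    (jostDomain_ne (jostDomain_shift hp ht)).2.2
  have h4 : ∀ p ∈ jostDomain, (p.1 + t) ^ 2 * ((p.1 + t) ^ 2 + p.2) ≠ 0 := fun p hp =>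
    mul_ne_zero (pow_ne_zero 2 (h2 p hp)) (h3 p hp)
  have h5 : ∀ p ∈ jostDomain, (p.1 + t) ^ 2 ≠ 0 := fun p hp => pow_ne_zero 2 (h2 p hp)
  simp only [div_eq_mul_inv]
  refine DifferentiableOn.mul (DifferentiableOn.mul (by fun_prop) (DifferentiableOn.mul
    (DifferentiableOn.mul (by fun_prop) (DifferentiableOn.mul (by fun_prop)
      (DifferentiableOn.inv (by fun_prop) h1)))
    (DifferentiableOn.mul (by fun_prop) (DifferentiableOn.inv (by fun_prop) h5))))
    (DifferentiableOn.inv (by fun_prop) h4)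

lemma integral_Ioi_inv_add_pow {a : ℝ} (ha : 0 < a) (n : ℕ) :
    IntegrableOn (fun t : ℝ => ((a + t) ^ (n + 2))⁻¹) (Set.Ioi 0) ∧
      ∫ t in Set.Ioi (0 : ℝ), ((a + t) ^ (n + 2))⁻¹ = ((n + 1) * a ^ (n + 1))⁻¹ := by
  have hderiv : ∀ t ∈ Set.Ici (0 : ℝ), HasDerivAt
      (fun t : ℝ => -((n + 1) * (a + t) ^ (n + 1))⁻¹) (((a + t) ^ (n + 2))⁻¹) t := by
    intro t ht
    have hat : 0 < a + t := add_pos_of_pos_of_nonneg ha ht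
    have h1 : HasDerivAt (fun t : ℝ => ((n : ℝ) + 1) * (a + t) ^ (n + 1))
        ((n + 1) * ((n + 1 : ℕ) * (a + t) ^ n * 1)) t := by
      have := (((hasDerivAt_id t).const_add a).pow (n + 1)).const_mul ((n : ℝ) + 1)
      simpa using this
    have h2 : HasDerivAt (fun t : ℝ => -((n + 1) * (a + t) ^ (n + 1))⁻¹) _ t :=
      (h1.inv (by positivity)).neg
    refine h2.congr_deriv ?_
    push_cast
    field_simp
    ring
  have hlim : Tendsto (fun t : ℝ => -((n + 1) * (a + t) ^ (n + 1))⁻¹) atTop (𝓝 0) := by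
    rw [← neg_zero]
    refine Tendsto.neg (tendsto_inv_atTop_zero.comp ?_)
    refine Tendsto.const_mul_atTop (by positivity) ?_
    exact (tendsto_pow_atTop (by omega)).comp (tendsto_atTop_add_const_left _ a tendsto_id)
  have hpos : ∀ t ∈ Set.Ioi (0 : ℝ), 0 ≤ ((a + t) ^ (n + 2))⁻¹ := by
    intro t ht
    have hat : 0 < a + t := add_pos ha ht
    positivity
  refine ⟨integrableOn_Ioi_deriv_of_nonneg' hderiv hpos hlim, ?_⟩
  rw [integral_Ioi_of_hasDerivAt_of_nonneg' hderiv hpos hlim]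
  simp

/-! ### Picard iteration -/

/-- The Volterra operator with kernel `rhoKernel`. -/
def volterra (M : ℂ × ℂ → ℂ) (p : ℂ × ℂ) : ℂ :=
  ∫ t in Set.Ioi (0 : ℝ), rhoKernel p t * M (p.1 + t, p.2)

lemma continuousOn_volterra_integrand {M : ℂ × ℂ → ℂ} (hM : ContinuousOn M jostDomain)
    {p : ℂ × ℂ} (hp : p ∈ jostDomain) :
    ContinuousOn (fun t : ℝ => rhoKernel p t * M (p.1 + t, p.2)) (Set.Ici 0) :=
  (continuousOn_rhoKernel hp).mul
    (hM.comp (f := fun t : ℝ => (p.1 + t, p.2)) (by fun_prop) fun _ ht => jostDomain_shift hp ht)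

lemma aestronglyMeasurable_volterra_integrand {M : ℂ × ℂ → ℂ} (hM : ContinuousOn M jostDomain)
    {p : ℂ × ℂ} (hp : p ∈ jostDomain) :
    AEStronglyMeasurable (fun t : ℝ => rhoKernel p t * M (p.1 + t, p.2))
      (volume.restrict (Set.Ioi 0)) :=
  ((continuousOn_volterra_integrand hM hp).mono Set.Ioi_subset_Ici_self).aestronglyMeasurable
    measurableSet_Ioi

lemma integrableOn_volterra_integrand {M : ℂ × ℂ → ℂ} (hM : ContinuousOn M jostDomain) {c : ℝ}
    (hc : ∀ p ∈ jostDomain, ‖M p‖ ≤ c) {p : ℂ × ℂ} (hp : p ∈ jostDomain) :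
    IntegrableOn (fun t : ℝ => rhoKernel p t * M (p.1 + t, p.2)) (Set.Ioi 0) := by
  have h0 := jostDomain_re_pos hp
  refine (((integral_Ioi_inv_add_pow h0 1).1.const_mul 56).mul_const c).mono'
    (aestronglyMeasurable_volterra_integrand hM hp) ?_
  filter_upwards [ae_restrict_mem measurableSet_Ioi] with t ht
  have ht' : 0 ≤ t := le_of_lt ht
  rw [norm_mul]
  have : 0 < p.1.re + t := by positivity
  exact mul_le_mul (norm_rhoKernel_le_cube hp ht') (hc _ (jostDomain_shift hp ht'))
    (norm_nonneg _) (by positivity)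

lemma differentiableOn_volterra {M : ℂ × ℂ → ℂ} (hM : DifferentiableOn ℂ M jostDomain) {c : ℝ}
    (hc : ∀ p ∈ jostDomain, ‖M p‖ ≤ c) : DifferentiableOn ℂ (volterra M) jostDomain := by
  intro p hp
  have h0 := jostDomain_re_pos hp
  set U : Set (ℂ × ℂ) := jostDomain ∩ {q | p.1.re / 2 < q.1.re} with hU
  have hUo : IsOpen U := by
    have : IsOpen {q : ℂ × ℂ | p.1.re / 2 < q.1.re} := isOpen_lt (by fun_prop) (by fun_prop)
    exact isOpen_jostDomain.inter this
  have hpU : p ∈ U := ⟨hp, by simp only [Set.mem_ofPred_eq]; linarith⟩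
  have h0' : 0 < p.1.re / 2 := by positivity
  have key : DifferentiableOn ℂ (volterra M) U := by
    refine differentiableOn_integral_param
      (bound := fun t => 56 * ((p.1.re / 2 + t) ^ (1 + 2))⁻¹ * c) hUo
      (fun q hq => aestronglyMeasurable_volterra_integrand hM.continuousOn hq.1) ?_ ?_
      (((integral_Ioi_inv_add_pow h0' 1).1.const_mul 56).mul_const c)
    · filter_upwards [ae_restrict_mem measurableSet_Ioi] with t ht
      have ht' : 0 ≤ t := le_of_lt ht
      refine ((differentiableOn_rhoKernel ht').mono Set.inter_subset_left).mul ?_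
      exact hM.comp (f := fun q : ℂ × ℂ => (q.1 + t, q.2)) (by fun_prop)
        fun q hq => jostDomain_shift hq.1 ht'
    · filter_upwards [ae_restrict_mem measurableSet_Ioi] with t ht q hq
      have ht' : 0 ≤ t := le_of_lt ht
      rw [norm_mul]
      have h1 : p.1.re / 2 < q.1.re := hq.2
      have : 0 < p.1.re / 2 + t := by positivity
      refine mul_le_mul ((norm_rhoKernel_le_cube hq.1 ht').trans ?_)
        (hc _ (jostDomain_shift hq.1 ht')) (norm_nonneg _) (by positivity)
      gcongr
  exact (key.differentiableAt (hUo.mem_nhds hpU)).differentiableWithinAt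

/-- The Picard iterates for the equation `M = 1 + ζ · volterra M`. -/
def picard : ℕ → ℂ × ℂ → ℂ
  | 0 => fun _ => 1
  | n + 1 => fun p => p.2 * volterra (picard n) p

/-- A bound for the `n`-th Picard iterate. -/
def picardBound (n : ℕ) : ℝ := 112 ^ n / n.factorial

lemma summable_picardBound : Summable picardBound := Real.summable_pow_div_factorial 112

lemma picardBound_nonneg (n : ℕ) : 0 ≤ picardBound n := by unfold picardBound; positivity

lemma norm_le_picardBound {M : ℂ × ℂ → ℂ} {n : ℕ}
    (h : ∀ p ∈ jostDomain, ‖M p‖ ≤ (28 * ‖p.2‖) ^ n / n.factorial * (p.1.re ^ (2 * n))⁻¹)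
    {p : ℂ × ℂ} (hp : p ∈ jostDomain) : ‖M p‖ ≤ picardBound n := by
  refine (h p hp).trans ?_
  have h0 := jostDomain_re_pos hp
  have h1 : 28 * ‖p.2‖ ≤ 112 * p.1.re ^ 2 := by linarith [hp.2.2]
  calc (28 * ‖p.2‖) ^ n / n.factorial * (p.1.re ^ (2 * n))⁻¹
      ≤ (112 * p.1.re ^ 2) ^ n / n.factorial * (p.1.re ^ (2 * n))⁻¹ := by gcongr
    _ = picardBound n := by
      unfold picardBound
      rw [mul_pow, ← pow_mul]
      field_simp

lemma picard_spec (n : ℕ) : DifferentiableOn ℂ (picard n) jostDomain ∧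
    ∀ p ∈ jostDomain, ‖picard n p‖ ≤ (28 * ‖p.2‖) ^ n / n.factorial * (p.1.re ^ (2 * n))⁻¹ := by
  induction n with
  | zero => exact ⟨differentiableOn_const _, fun p _ => by simp [picard]⟩
  | succ n ih =>
    obtain ⟨ih1, ih2⟩ := ih
    refine ⟨?_, fun p hp => ?_⟩
    · exact (differentiable_snd.differentiableOn).mul
        (differentiableOn_volterra ih1 fun p hp => norm_le_picardBound ih2 hp)
    · have h0 := jostDomain_re_pos hp
      have hI := integral_Ioi_inv_add_pow h0 (2 * n + 1)
      have hbd : ‖volterra (picard n) p‖ ≤ ∫ t in Set.Ioi (0 : ℝ),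
          (56 * ((28 * ‖p.2‖) ^ n / n.factorial)) * ((p.1.re + t) ^ (2 * n + 1 + 2))⁻¹ := by
        refine norm_integral_le_of_norm_le (hI.1.const_mul _) ?_
        filter_upwards [ae_restrict_mem measurableSet_Ioi] with t ht
        have ht' : 0 ≤ t := le_of_lt ht
        have hat : 0 < p.1.re + t := by positivity
        have h1 := ih2 _ (jostDomain_shift hp ht')
        simp only [add_re, ofReal_re] at h1
        rw [norm_mul]
        calc ‖rhoKernel p t‖ * ‖picard n (p.1 + t, p.2)‖
            ≤ (56 * ((p.1.re + t) ^ 3)⁻¹) *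
              ((28 * ‖p.2‖) ^ n / n.factorial * ((p.1.re + t) ^ (2 * n))⁻¹) :=
              mul_le_mul (norm_rhoKernel_le_cube hp ht') h1 (norm_nonneg _) (by positivity)
          _ = _ := by rw [show 2 * n + 1 + 2 = 3 + 2 * n by ring, pow_add, mul_inv]; ring
      rw [integral_const_mul, hI.2] at hbd
      rw [picard, norm_mul]
      calc ‖p.2‖ * ‖volterra (picard n) p‖
          ≤ ‖p.2‖ * _ := mul_le_mul_of_nonneg_left hbd (norm_nonneg _)
        _ = _ := by
          rw [Nat.factorial_succ, show 2 * (n + 1) = 2 * n + 1 + 1 by ring]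
          push_cast
          field_simp
          ring

lemma norm_picard_le (n : ℕ) {p : ℂ × ℂ} (hp : p ∈ jostDomain) : ‖picard n p‖ ≤ picardBound n :=
  norm_le_picardBound (picard_spec n).2 hp

/-- The quotient `f / h₊` as a holomorphic function of `(u, ζ)`. -/
def jostQuotient (p : ℂ × ℂ) : ℂ := ∑' n, picard n p

/-- The holomorphic function `ρ(u, ζ)` such that `ρ₁(u, ξ) = ρ(u, ξ²)`. -/
def rhoHol : ℂ × ℂ → ℂ := volterra jostQuotient

lemma norm_jostQuotient_le {p : ℂ × ℂ} (hp : p ∈ jostDomain) :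
    ‖jostQuotient p‖ ≤ ∑' n, picardBound n :=
  tsum_of_norm_bounded summable_picardBound.hasSum fun n => norm_picard_le n hp

lemma differentiableOn_jostQuotient : DifferentiableOn ℂ jostQuotient jostDomain := by
  have hint : Integrable picardBound Measure.count := by
    rw [integrable_count_iff]
    exact summable_picardBound.norm
  have h := differentiableOn_integral_param (μ := Measure.count) (F := fun p n => picard n p)
    isOpen_jostDomain (fun _ _ => (measurable_from_nat).aestronglyMeasurable)
    (Eventually.of_forall fun n => (picard_spec n).1)
    (Eventually.of_forall fun n p hp => norm_picard_le n hp) hint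
  refine h.congr fun p hp => ?_
  rw [integral_countable (hint.mono' (measurable_from_nat).aestronglyMeasurable
    (Eventually.of_forall fun n => norm_picard_le n hp))]
  simp [jostQuotient, Measure.real]

lemma jostQuotient_eq {p : ℂ × ℂ} (hp : p ∈ jostDomain) :
    jostQuotient p = 1 + p.2 * rhoHol p := by
  have h0 := jostDomain_re_pos hp
  have hsum : Summable fun n => picard n p :=
    Summable.of_norm_bounded summable_picardBound fun n => norm_picard_le n hp
  have hint := fun n => integrableOn_volterra_integrand (picard_spec n).1.continuousOn
    (fun q hq => norm_picard_le n hq) hp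
  have hinterchange : ∑' n, volterra (picard n) p = rhoHol p := by
    unfold rhoHol volterra
    rw [integral_tsum_of_summable_integral_norm hint]
    · refine setIntegral_congr_fun measurableSet_Ioi fun t ht => ?_
      simp only [jostQuotient]
      rw [tsum_mul_left]
    · refine Summable.of_nonneg_of_le (fun n => integral_nonneg fun _ => norm_nonneg _)
        (fun n => ?_) (summable_picardBound.mul_left
          (∫ t in Set.Ioi (0 : ℝ), 56 * ((p.1.re + t) ^ (1 + 2))⁻¹))
      rw [← integral_mul_const]
      refine setIntegral_mono_on (hint n).norm
        (((integral_Ioi_inv_add_pow h0 1).1.const_mul 56).mul_const _) measurableSet_Ioi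
        fun t ht => ?_
      have ht' : 0 ≤ t := le_of_lt ht
      have : 0 < p.1.re + t := by positivity
      rw [norm_mul]
      exact mul_le_mul (norm_rhoKernel_le_cube hp ht') (norm_picard_le n (jostDomain_shift hp ht'))
        (norm_nonneg _) (by positivity)
  rw [jostQuotient, hsum.tsum_eq_zero_add, ← hinterchange, ← tsum_mul_left]
  rfl

lemma differentiableOn_rhoHol : DifferentiableOn ℂ rhoHol jostDomain :=
  differentiableOn_volterra differentiableOn_jostQuotient fun _ => norm_jostQuotient_le

/-- The weight in the symbol bounds. -/
def rhoWeight (u : ℝ) : ℝ := (1 + (u⁻¹) ^ 2) * ((1 + u)⁻¹) ^ 3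

lemma exists_norm_rhoHol_le : ∃ c : ℝ, 0 < c ∧ ∀ p ∈ jostDomain,
    ‖rhoHol p‖ ≤ c * rhoWeight p.1.re ∧ ‖rhoHol p‖ ≤ c * (p.1.re ^ 2)⁻¹ := by
  set S := ∑' n, picardBound n with hS
  have hS0 : 0 ≤ S := tsum_nonneg picardBound_nonneg
  have main : ∀ p ∈ jostDomain, ‖rhoHol p‖ ≤ 28 * S * (p.1.re ^ 2)⁻¹ ∧
      ‖rhoHol p‖ ≤ 28 * S * (p.1.re ^ 3)⁻¹ := by
    intro p hp
    have h0 := jostDomain_re_pos hp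
    have hmeas : ∀ t ∈ Set.Ioi (0 : ℝ), ‖jostQuotient (p.1 + t, p.2)‖ ≤ S := fun t ht =>
      norm_jostQuotient_le (jostDomain_shift hp (le_of_lt ht))
    constructor
    · have hI := integral_Ioi_inv_add_pow h0 1
      have hbd : ‖rhoHol p‖ ≤ ∫ t in Set.Ioi (0 : ℝ), (56 * S) * ((p.1.re + t) ^ (1 + 2))⁻¹ := by
        refine norm_integral_le_of_norm_le (hI.1.const_mul _) ?_
        filter_upwards [ae_restrict_mem measurableSet_Ioi] with t ht
        have hat : 0 < p.1.re + t := add_pos h0 ht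
        rw [norm_mul]
        calc _ ≤ (56 * ((p.1.re + t) ^ 3)⁻¹) * S :=
              mul_le_mul (norm_rhoKernel_le_cube hp (le_of_lt ht)) (hmeas t ht) (norm_nonneg _)
                (by positivity)
          _ = _ := by ring
      rw [integral_const_mul, hI.2] at hbd
      refine hbd.trans (le_of_eq ?_)
      norm_num
      field_simp
      ring
    · have hI := integral_Ioi_inv_add_pow h0 2
      have hbd : ‖rhoHol p‖ ≤ ∫ t in Set.Ioi (0 : ℝ), (56 * S) * ((p.1.re + t) ^ (2 + 2))⁻¹ := by
        refine norm_integral_le_of_norm_le (hI.1.const_mul _) ?_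
        filter_upwards [ae_restrict_mem measurableSet_Ioi] with t ht
        have hat : 0 < p.1.re + t := add_pos h0 ht
        have hk : ‖rhoKernel p t‖ ≤ 56 * ((p.1.re + t) ^ 4)⁻¹ := by
          refine (norm_rhoKernel_le hp (le_of_lt ht)).trans ?_
          gcongr
          linarith [min_le_left 1 (p.1.re + t)]
        rw [norm_mul]
        calc _ ≤ (56 * ((p.1.re + t) ^ 4)⁻¹) * S :=
              mul_le_mul hk (hmeas t ht) (norm_nonneg _) (by positivity)
          _ = _ := by ring
      rw [integral_const_mul, hI.2] at hbd
      refine hbd.trans ?_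
      have : ((((2 : ℕ) : ℝ) + 1) * p.1.re ^ (2 + 1))⁻¹ = (p.1.re ^ 3)⁻¹ / 3 := by
        norm_num
        ring
      rw [this]
      have : 0 ≤ S * (p.1.re ^ 3)⁻¹ := by positivity
      linarith
  refine ⟨224 * S + 1, by positivity, fun p hp => ?_⟩
  obtain ⟨h2, h3⟩ := main p hp
  have h0 := jostDomain_re_pos hp
  set a := p.1.re with ha
  constructor
  · have hw : 28 * S * rhoWeight a * 8 ≤ (224 * S + 1) * rhoWeight a := by
      have : 0 ≤ rhoWeight a := by unfold rhoWeight; positivity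
      nlinarith
    refine le_trans ?_ hw
    rcases le_total a 1 with h1 | h1
    · refine h2.trans ?_
      rw [mul_assoc (28 * S)]
      refine mul_le_mul_of_nonneg_left ?_ (by positivity)
      have h8 : 1 ≤ ((1 + a)⁻¹) ^ 3 * 8 := by
        have : (1 + a) ^ 3 ≤ 2 ^ 3 := by gcongr; linarith
        rw [inv_pow, inv_mul_eq_div, le_div_iff₀ (by positivity)]
        linarith
      have hle : (a ^ 2)⁻¹ ≤ 1 + (a⁻¹) ^ 2 := by rw [inv_pow]; linarith
      rw [rhoWeight, mul_assoc]
      calc (a ^ 2)⁻¹ = (a ^ 2)⁻¹ * 1 := (mul_one _).symm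
        _ ≤ _ := mul_le_mul hle h8 zero_le_one (by positivity)
    · refine h3.trans ?_
      rw [mul_assoc (28 * S)]
      refine mul_le_mul_of_nonneg_left ?_ (by positivity)
      have h8 : (a ^ 3)⁻¹ ≤ ((1 + a)⁻¹) ^ 3 * 8 := by
        have : (1 + a) ^ 3 ≤ (2 * a) ^ 3 := by gcongr; linarith
        rw [inv_pow, inv_mul_eq_div, le_div_iff₀ (by positivity), inv_mul_le_iff₀ (by positivity)]
        linarith
      have hle : 1 ≤ 1 + (a⁻¹) ^ 2 := by
        have : 0 ≤ (a⁻¹) ^ 2 := by positivity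
        linarith
      rw [rhoWeight, mul_assoc]
      calc (a ^ 3)⁻¹ = 1 * (a ^ 3)⁻¹ := (one_mul _).symm
        _ ≤ _ := mul_le_mul hle h8 (by positivity) (by positivity)
  · refine h2.trans ?_
    gcongr
    linarith

/-! ### The differential equation -/

lemma hasDerivAt_integral_Ioi {g : ℝ → ℂ} {b u : ℝ} (hg : ContinuousOn g (Set.Ioi b))
    (hint : ∀ c, b < c → IntegrableOn g (Set.Ioi c)) (hu : b < u) :
    HasDerivAt (fun w => ∫ v in Set.Ioi w, g v) (-g u) u := by
  obtain ⟨c, hbc, hcu⟩ := exists_between hu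
  have h1 : HasDerivAt (fun w => ∫ v in c..w, g v) (g u) u := by
    refine intervalIntegral.integral_hasDerivAt_right ?_ ?_ ?_
    · refine (intervalIntegrable_iff_integrableOn_Ioc_of_le hcu.le).2
        ((hint c hbc).mono_set Set.Ioc_subset_Ioi_self)
    · exact hg.stronglyMeasurableAtFilter isOpen_Ioi u hu
    · exact hg.continuousAt (Ioi_mem_nhds hu)
  refine (h1.const_sub (∫ v in Set.Ioi c, g v)).congr_of_eventuallyEq ?_
  filter_upwards [Ioi_mem_nhds hcu] with w hw
  rw [← intervalIntegral.integral_Ioi_sub_Ioi (hint c hbc) (le_of_lt hw)]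
  ring

/-- `h₋(u) = e^{-iu}(1 - i/u)`, the complex conjugate of `h₊`. -/
def hminus (u : ℝ) : ℂ := exp (-(I * u)) * (1 - I / u)

/-- The derivative of `h₊`. -/
def hplusDeriv (u : ℝ) : ℂ := exp (I * u) * (I * (1 + I / u) - I / u ^ 2)

/-- The derivative of `h₋`. -/
def hminusDeriv (u : ℝ) : ℂ := exp (-(I * u)) * (-I * (1 - I / u) + I / u ^ 2)

section

variable {u : ℝ}

lemma hasDerivAt_I_mul : HasDerivAt (fun v : ℝ => I * (v : ℂ)) I u := by
  simpa using (hasDerivAt_id u).ofReal_comp.const_mul I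

lemma hasDerivAt_I_div (hu : u ≠ 0) : HasDerivAt (fun v : ℝ => I / (v : ℂ)) (-I / u ^ 2) u := by
  have hu' : (u : ℂ) ≠ 0 := ofReal_ne_zero.2 hu
  have h := ((hasDerivAt_id u).ofReal_comp.fun_inv (by simpa using hu')).const_mul I
  simp only [id] at h
  simp only [div_eq_mul_inv] at h ⊢
  refine h.congr_deriv ?_
  push_cast
  ring

lemma hasDerivAt_I_div_sq (hu : u ≠ 0) :
    HasDerivAt (fun v : ℝ => I / (v : ℂ) ^ 2) (-2 * I / u ^ 3) u := by
  have hu' : (u : ℂ) ≠ 0 := ofReal_ne_zero.2 hu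
  have h := (((hasDerivAt_id u).ofReal_comp.fun_pow 2).fun_inv
    (by simpa using hu')).const_mul I
  simp only [id] at h
  simp only [div_eq_mul_inv] at h ⊢
  refine h.congr_deriv ?_
  push_cast
  field_simp

lemma hasDerivAt_hplus (hu : u ≠ 0) : HasDerivAt hplus (hplusDeriv u) u := by
  have h : HasDerivAt hplus _ u :=
    (hasDerivAt_I_mul (u := u)).cexp.mul ((hasDerivAt_I_div hu).const_add 1)
  refine h.congr_deriv ?_
  rw [hplusDeriv]
  ring

lemma hasDerivAt_hminus (hu : u ≠ 0) : HasDerivAt hminus (hminusDeriv u) u := by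
  have h : HasDerivAt hminus _ u :=
    (hasDerivAt_I_mul (u := u)).fun_neg.cexp.mul ((hasDerivAt_I_div hu).const_sub 1)
  refine h.congr_deriv ?_
  rw [hminusDeriv]
  ring

lemma hasDerivAt_hplusDeriv (hu : u ≠ 0) :
    HasDerivAt hplusDeriv ((2 / u ^ 2 - 1) * hplus u) u := by
  have hu' : (u : ℂ) ≠ 0 := ofReal_ne_zero.2 hu
  have h : HasDerivAt hplusDeriv _ u := (hasDerivAt_I_mul (u := u)).cexp.mul
    ((((hasDerivAt_I_div hu).const_add 1).const_mul I).fun_sub (hasDerivAt_I_div_sq hu))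
  refine h.congr_deriv ?_
  rw [hplus]
  field_simp
  ring_nf
  simp only [I_sq, I_pow_three]
  ring

lemma hasDerivAt_hminusDeriv (hu : u ≠ 0) :
    HasDerivAt hminusDeriv ((2 / u ^ 2 - 1) * hminus u) u := by
  have hu' : (u : ℂ) ≠ 0 := ofReal_ne_zero.2 hu
  have h : HasDerivAt hminusDeriv _ u := (hasDerivAt_I_mul (u := u)).fun_neg.cexp.mul
    ((((hasDerivAt_I_div hu).const_sub 1).const_mul (-I)).fun_add (hasDerivAt_I_div_sq hu))
  refine h.congr_deriv ?_
  rw [hminus]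
  field_simp
  ring_nf
  simp only [I_sq, I_pow_three]
  ring

lemma wronskian_hplus_hminus (hu : u ≠ 0) :
    hminus u * hplusDeriv u - hplus u * hminusDeriv u = 2 * I := by
  have hu' : (u : ℂ) ≠ 0 := ofReal_ne_zero.2 hu
  have he : exp (I * u) * exp (-(I * u)) = 1 := by rw [← Complex.exp_add]; simp
  have e : hminus u * hplusDeriv u - hplus u * hminusDeriv u =
      (exp (I * u) * exp (-(I * u))) * (2 * I * (1 + I / u) * (1 - I / u)
        - I / u ^ 2 * (1 - I / u) - I / u ^ 2 * (1 + I / u)) := by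
    rw [hminus, hplusDeriv, hplus, hminusDeriv]; ring
  rw [e, he]
  field_simp
  ring_nf
  simp only [I_sq]
  ring

lemma jostKernel_mul_hplus (hu : 0 < u) {t : ℝ} (ht : 0 ≤ t) :
    jostKernel u t * hplus u =
      I / 2 * (hminus (u + t) * hplus u - hplus (u + t) * hminus u) * hplus (u + t) := by
  have hu' : (u : ℂ) ≠ 0 := ofReal_ne_zero.2 hu.ne'
  have hv' : (u + t : ℂ) ≠ 0 := by exact_mod_cast (by positivity : u + t ≠ 0)
  have huI : (u + I : ℂ) ≠ 0 := fun h => by simpa [hu.ne'] using congrArg re h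
  rw [jostKernel, hplus, hplus, hminus, hminus]
  simp only [ofReal_add, ofReal_sin, ofReal_cos, Complex.sin, Complex.cos, mul_add, neg_add,
    Complex.exp_add, Complex.exp_neg, mul_comm _ I, mul_neg]
  have hE := Complex.exp_ne_zero (I * u)
  have he := Complex.exp_ne_zero (I * t)
  generalize exp (I * u) = E at *
  generalize exp (I * t) = e at *
  field_simp
  ring_nf
  simp only [I_sq, I_pow_three, I_pow_four]
  ring

lemma norm_hplus_le (hu : 0 < u) : ‖hplus u‖ ≤ 1 + u⁻¹ := by
  rw [hplus, norm_mul, mul_comm I, norm_exp_ofReal_mul_I, one_mul]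
  refine (norm_add_le _ _).trans (le_of_eq ?_)
  simp [abs_of_pos hu]

lemma norm_hminus_le (hu : 0 < u) : ‖hminus u‖ ≤ 1 + u⁻¹ := by
  have : -(I * (u : ℂ)) = ((-u : ℝ) : ℂ) * I := by push_cast; ring
  rw [hminus, norm_mul, this, norm_exp_ofReal_mul_I, one_mul]
  refine (norm_sub_le _ _).trans (le_of_eq ?_)
  simp [abs_of_pos hu]

end

lemma ofReal_mem_jostDomain {u ζ : ℝ} (hu : 0 < u) (hζ : 0 ≤ ζ) (h : ζ < 4 * u ^ 2) :
    ((u : ℂ), (ζ : ℂ)) ∈ jostDomain := by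
  refine ⟨by simpa using hu, ?_, ?_⟩
  · simp only [ofReal_re]; nlinarith
  · simpa [abs_of_nonneg hζ] using h

/-- The Jost solution `h₊(u)(1 + ξ²ρ₁(u, ξ))` as a function of `u = xξ`. -/
def jostFun (ξ u : ℝ) : ℂ := hplus u * jostQuotient (u, (ξ : ℂ) ^ 2)

/-- The perturbation `2/(u² + ξ²) - 2/u²` of the inverse square potential. -/
def potentialDiff (ξ u : ℝ) : ℂ := -2 * (ξ : ℂ) ^ 2 / ((u : ℂ) ^ 2 * ((u : ℂ) ^ 2 + (ξ : ℂ) ^ 2))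

section

variable {ξ : ℝ}

lemma mem_jostDomain_of_half_lt (hξ : 0 < ξ) {u : ℝ} (hu : ξ / 2 < u) :
    ((u : ℂ), (ξ : ℂ) ^ 2) ∈ jostDomain := by
  have := ofReal_mem_jostDomain (u := u) (ζ := ξ ^ 2) (by linarith) (by positivity) (by nlinarith)
  simpa using this

lemma continuousOn_potentialDiff_mul_jostFun (hξ : 0 < ξ) :
    ContinuousOn (fun v => potentialDiff ξ v * jostFun ξ v) (Set.Ioi (ξ / 2)) := by
  have h0 : ∀ v ∈ Set.Ioi (ξ / 2), (v : ℂ) ≠ 0 := fun v hv =>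
    (jostDomain_ne (mem_jostDomain_of_half_lt hξ hv)).1
  have h1 : ∀ v ∈ Set.Ioi (ξ / 2), (v : ℂ) ^ 2 + (ξ : ℂ) ^ 2 ≠ 0 := fun v hv =>
    (jostDomain_ne (mem_jostDomain_of_half_lt hξ hv)).2.2
  unfold potentialDiff jostFun
  refine ContinuousOn.mul (ContinuousOn.div (by fun_prop) (by fun_prop) fun v hv =>
    mul_ne_zero (pow_ne_zero 2 (h0 v hv)) (h1 v hv)) (ContinuousOn.mul ?_ ?_)
  · exact fun v hv => (hasDerivAt_hplus
      (ofReal_ne_zero.1 (h0 v hv))).continuousAt.continuousWithinAt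
  · exact differentiableOn_jostQuotient.continuousOn.comp
      (f := fun v : ℝ => ((v : ℂ), (ξ : ℂ) ^ 2)) (by fun_prop)
      fun v hv => mem_jostDomain_of_half_lt hξ hv

lemma integrableOn_potentialDiff (hξ : 0 < ξ) {g : ℝ → ℂ}
    (hg : ContinuousOn g (Set.Ioi (ξ / 2))) (hgb : ∀ v, 0 < v → ‖g v‖ ≤ 1 + v⁻¹) {c : ℝ}
    (hc : ξ / 2 < c) :
    IntegrableOn (fun v => g v * (potentialDiff ξ v * jostFun ξ v)) (Set.Ioi c) := by
  have hc0 : 0 < c := by linarith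
  set S := ∑' n, picardBound n with hS
  have hS0 : 0 ≤ S := tsum_nonneg picardBound_nonneg
  refine ((integrableOn_Ioi_rpow_of_lt (by norm_num : (-2 : ℝ) < -1) hc0).const_mul
    ((1 + c⁻¹) * (2 * ξ ^ 2 / c ^ 2 * ((1 + c⁻¹) * S)))).mono' ?_ ?_
  · exact ((hg.mul (continuousOn_potentialDiff_mul_jostFun hξ)).mono
      (Set.Ioi_subset_Ioi hc.le)).aestronglyMeasurable measurableSet_Ioi
  · filter_upwards [ae_restrict_mem measurableSet_Ioi] with v hv
    have hcv : c ≤ v := le_of_lt hv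
    have hv0 : 0 < v := hc0.trans_le hcv
    have hvc : 1 + v⁻¹ ≤ 1 + c⁻¹ := by gcongr
    have hQ : ‖potentialDiff ξ v‖ ≤ 2 * ξ ^ 2 / c ^ 2 * (v ^ 2)⁻¹ := by
      have e : potentialDiff ξ v = ((-(2 * ξ ^ 2 / (v ^ 2 * (v ^ 2 + ξ ^ 2))) : ℝ) : ℂ) := by
        rw [potentialDiff]; push_cast; ring
      rw [e, norm_real, norm_neg, Real.norm_of_nonneg (by positivity), ← div_eq_mul_inv,
        div_div]
      gcongr 2 * ξ ^ 2 / ?_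
      rw [mul_comm]
      gcongr
      nlinarith
    have hJ : ‖jostFun ξ v‖ ≤ (1 + c⁻¹) * S := by
      rw [jostFun, norm_mul]
      exact mul_le_mul ((norm_hplus_le hv0).trans hvc)
        (norm_jostQuotient_le (mem_jostDomain_of_half_lt hξ (hc.trans hv)))
        (norm_nonneg _) (by positivity)
    have hr : v ^ (-2 : ℝ) = (v ^ 2)⁻¹ := by
      rw [Real.rpow_neg hv0.le]; norm_num
    rw [norm_mul, norm_mul, hr]
    calc ‖g v‖ * (‖potentialDiff ξ v‖ * ‖jostFun ξ v‖)
        ≤ (1 + c⁻¹) * ((2 * ξ ^ 2 / c ^ 2 * (v ^ 2)⁻¹) * ((1 + c⁻¹) * S)) := by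
          gcongr
          exact (hgb v hv0).trans hvc
      _ = _ := by ring

lemma continuousOn_hplus : ContinuousOn hplus (Set.Ioi 0) := fun _ hv =>
  (hasDerivAt_hplus (ne_of_gt hv)).continuousAt.continuousWithinAt

lemma continuousOn_hminus : ContinuousOn hminus (Set.Ioi 0) := fun _ hv =>
  (hasDerivAt_hminus (ne_of_gt hv)).continuousAt.continuousWithinAt

/-- The tail integral `∫_u^∞ g (V - 2/u²) f`. -/
def tailIntegral (g : ℝ → ℂ) (ξ u : ℝ) : ℂ :=
  ∫ v in Set.Ioi u, g v * (potentialDiff ξ v * jostFun ξ v)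

lemma hasDerivAt_tailIntegral (hξ : 0 < ξ) {g : ℝ → ℂ} (hg : ContinuousOn g (Set.Ioi 0))
    (hgb : ∀ v, 0 < v → ‖g v‖ ≤ 1 + v⁻¹) {u : ℝ} (hu : ξ / 2 < u) :
    HasDerivAt (tailIntegral g ξ) (-(g u * (potentialDiff ξ u * jostFun ξ u))) u := by
  have hg' := hg.mono (Set.Ioi_subset_Ioi (by positivity : 0 ≤ ξ / 2))
  exact hasDerivAt_integral_Ioi (hg'.mul (continuousOn_potentialDiff_mul_jostFun hξ))
    (fun c hc => integrableOn_potentialDiff hξ hg' hgb hc) hu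

lemma integral_Ioi_zero_add (g : ℝ → ℂ) (u : ℝ) :
    ∫ t in Set.Ioi (0 : ℝ), g (u + t) = ∫ v in Set.Ioi u, g v := by
  have h := (measurePreserving_add_left volume u).setIntegral_preimage_emb
    (measurableEmbedding_addLeft u) g (Set.Ioi u)
  rw [← h]
  simp

lemma jostFun_eq (hξ : 0 < ξ) {u : ℝ} (hu : ξ / 2 < u) :
    jostFun ξ u = hplus u + I / 2 * (hplus u * tailIntegral hminus ξ u
      - hminus u * tailIntegral hplus ξ u) := by
  have hu0 : 0 < u := by linarith
  have hp := mem_jostDomain_of_half_lt hξ hu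
  have h0ξ : (0 : ℝ) ≤ ξ / 2 := by positivity
  have hm := integrableOn_potentialDiff hξ (continuousOn_hminus.mono (Set.Ioi_subset_Ioi h0ξ))
    (fun v hv => norm_hminus_le hv) hu
  have hpl := integrableOn_potentialDiff hξ (continuousOn_hplus.mono (Set.Ioi_subset_Ioi h0ξ))
    (fun v hv => norm_hplus_le hv) hu
  rw [jostFun, jostQuotient_eq hp, mul_add, mul_one, rhoHol, volterra, tailIntegral, tailIntegral,
    ← integral_const_mul, ← integral_const_mul, ← integral_const_mul, ← integral_const_mul,
    ← integral_sub (hm.const_mul _) (hpl.const_mul _), ← integral_const_mul,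
    ← integral_Ioi_zero_add _ u]
  congr 1
  refine setIntegral_congr_fun measurableSet_Ioi fun t ht => ?_
  have hk := jostKernel_mul_hplus hu0 (le_of_lt (Set.mem_Ioi.1 ht))
  simp only [rhoKernel, potentialDiff, jostFun]
  push_cast at hk ⊢
  linear_combination (-2 * (ξ : ℂ) ^ 2 / (((u : ℂ) + t) ^ 2 * (((u : ℂ) + t) ^ 2 + (ξ : ℂ) ^ 2)) *
    jostQuotient ((u : ℂ) + t, (ξ : ℂ) ^ 2)) * hk

/-- The derivative of the Jost solution. -/
def jostFunDeriv (ξ u : ℝ) : ℂ := hplusDeriv u + I / 2 * (hplusDeriv u * tailIntegral hminus ξ u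
  - hminusDeriv u * tailIntegral hplus ξ u)

lemma hasDerivAt_jostFun (hξ : 0 < ξ) {u : ℝ} (hu : ξ / 2 < u) :
    HasDerivAt (jostFun ξ) (jostFunDeriv ξ u) u := by
  have hu0 : u ≠ 0 := by linarith
  have hA := hasDerivAt_tailIntegral hξ continuousOn_hminus (fun v hv => norm_hminus_le hv) hu
  have hB := hasDerivAt_tailIntegral hξ continuousOn_hplus (fun v hv => norm_hplus_le hv) hu
  have h := (hasDerivAt_hplus hu0).fun_add ((((hasDerivAt_hplus hu0).fun_mul hA).fun_sub
    ((hasDerivAt_hminus hu0).fun_mul hB)).const_mul (I / 2))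
  refine HasDerivAt.congr_of_eventuallyEq (h.congr_deriv ?_) ?_
  · rw [jostFunDeriv]; ring
  · filter_upwards [Ioi_mem_nhds hu] with v hv using jostFun_eq hξ hv

lemma hasDerivAt_jostFunDeriv (hξ : 0 < ξ) {u : ℝ} (hu : ξ / 2 < u) :
    HasDerivAt (jostFunDeriv ξ) ((2 / ((u : ℂ) ^ 2 + (ξ : ℂ) ^ 2) - 1) * jostFun ξ u) u := by
  have hu0 : u ≠ 0 := by linarith
  have hp := jostDomain_ne (mem_jostDomain_of_half_lt hξ hu)
  have hA := hasDerivAt_tailIntegral hξ continuousOn_hminus (fun v hv => norm_hminus_le hv) hu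
  have hB := hasDerivAt_tailIntegral hξ continuousOn_hplus (fun v hv => norm_hplus_le hv) hu
  have h := (hasDerivAt_hplusDeriv hu0).fun_add ((((hasDerivAt_hplusDeriv hu0).fun_mul hA).fun_sub
    ((hasDerivAt_hminusDeriv hu0).fun_mul hB)).const_mul (I / 2))
  refine HasDerivAt.congr_deriv (f := jostFunDeriv ξ) h ?_
  have hW := wronskian_hplus_hminus hu0
  have hf := jostFun_eq hξ hu
  have hQ : potentialDiff ξ u = 2 / ((u : ℂ) ^ 2 + (ξ : ℂ) ^ 2) - 2 / (u : ℂ) ^ 2 := by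
    have h1 := hp.1
    have h2 := hp.2.2
    simp only at h1 h2
    rw [potentialDiff]
    field_simp
    ring
  have e : (2 / ((u : ℂ) ^ 2 + (ξ : ℂ) ^ 2) - 1) * jostFun ξ u
      = (2 / (u : ℂ) ^ 2 - 1) * jostFun ξ u + potentialDiff ξ u * jostFun ξ u := by
    rw [hQ]; ring
  rw [e]
  linear_combination (-(2 / (u : ℂ) ^ 2 - 1)) * hf
    - (I / 2 * potentialDiff ξ u * jostFun ξ u) * hW - potentialDiff ξ u * jostFun ξ u * I_sq

end

/-! ### Symbol bounds -/

lemma rhoWeight_le_of_le_three_mul {u v : ℝ} (hu : 0 < u) (h : u ≤ 3 * v) :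
    rhoWeight v ≤ 243 * rhoWeight u := by
  have hv : 0 < v := by linarith
  have h1 : v⁻¹ ≤ 3 * u⁻¹ := by
    rw [← div_eq_mul_inv, le_div_iff₀ hu, inv_mul_le_iff₀ hv]; linarith
  have h2 : (1 + v)⁻¹ ≤ 3 * (1 + u)⁻¹ := by
    rw [← div_eq_mul_inv, le_div_iff₀ (by linarith), inv_mul_le_iff₀ (by linarith)]; linarith
  calc rhoWeight v ≤ (1 + (3 * u⁻¹) ^ 2) * (3 * (1 + u)⁻¹) ^ 3 := by
        rw [rhoWeight]; gcongr
    _ ≤ (9 * (1 + (u⁻¹) ^ 2)) * (3 * (1 + u)⁻¹) ^ 3 := by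
        gcongr; linarith [sq_nonneg u⁻¹]
    _ = 243 * rhoWeight u := by rw [rhoWeight]; ring

/-- A neighbourhood of `{t ≤ s}` in logarithmic coordinates. -/
def logRegion (δ : ℝ) : Set (ℂ × ℂ) :=
  {p | |p.1.im| < δ ∧ |p.2.im| < δ ∧ p.2.re < p.1.re + δ}

lemma isOpen_logRegion (δ : ℝ) : IsOpen (logRegion δ) := by
  have c1 : Continuous fun p : ℂ × ℂ => p.1.re := continuous_re.comp continuous_fst
  have c2 : Continuous fun p : ℂ × ℂ => p.1.im := continuous_im.comp continuous_fst
  have c3 : Continuous fun p : ℂ × ℂ => p.2.re := continuous_re.comp continuous_snd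
  have c4 : Continuous fun p : ℂ × ℂ => p.2.im := continuous_im.comp continuous_snd
  exact (isOpen_lt c2.abs continuous_const).inter
    ((isOpen_lt c4.abs continuous_const).inter (isOpen_lt c3 (c1.add continuous_const)))

lemma logRegion_mono {δ δ' : ℝ} (h : δ ≤ δ') : logRegion δ ⊆ logRegion δ' :=
  fun _ hp => ⟨hp.1.trans_le h, hp.2.1.trans_le h, hp.2.2.trans_le (by linarith)⟩

lemma ball_subset_logRegion {δ : ℝ} {p : ℂ × ℂ} (hp : p ∈ logRegion (δ / 4)) :
    Metric.ball p (δ / 4) ⊆ logRegion δ := by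
  intro q hq
  rw [mem_ball_iff_norm, Prod.norm_def, max_lt_iff] at hq
  obtain ⟨h1, h2⟩ := hq
  have a1 := (abs_re_le_norm (q - p).1).trans_lt h1
  have a2 := (abs_im_le_norm (q - p).1).trans_lt h1
  have b1 := (abs_re_le_norm (q - p).2).trans_lt h2
  have b2 := (abs_im_le_norm (q - p).2).trans_lt h2
  obtain ⟨c1, c2, c3⟩ := hp
  simp only [Prod.fst_sub, Prod.snd_sub, sub_re, sub_im, abs_lt] at *
  refine ⟨abs_lt.2 ⟨?_, ?_⟩, abs_lt.2 ⟨?_, ?_⟩, ?_⟩ <;> linarith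

/-- Functions on `{0 < ξ ≤ u}` that are, in logarithmic coordinates, the restriction of a
holomorphic function dominated by `rhoWeight`. -/
def IsLogSymbol (R : ℝ → ℝ → ℂ) : Prop :=
  ∃ δ C : ℝ, ∃ G : ℂ × ℂ → ℂ, 0 < δ ∧ δ ≤ 1 ∧ 0 < C ∧ DifferentiableOn ℂ G (logRegion δ) ∧
    (∀ p ∈ logRegion δ, ‖G p‖ ≤ C * rhoWeight (Real.exp p.1.re)) ∧
    ∀ u ξ : ℝ, 0 < u → 0 < ξ → Real.log ξ < Real.log u + δ →
      R u ξ = G ((Real.log u : ℂ), (Real.log ξ : ℂ))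

lemma ofReal_mem_logRegion {δ σ τ : ℝ} (hδ : 0 < δ) (h : τ < σ + δ) :
    ((σ : ℂ), (τ : ℂ)) ∈ logRegion δ := by
  refine ⟨?_, ?_, ?_⟩ <;> simpa

lemma norm_fderiv_apply_le_of_logRegion {δ C : ℝ} {G : ℂ × ℂ → ℂ} (hδ : 0 < δ) (hδ1 : δ ≤ 1)
    (hC : 0 < C) (hG : DifferentiableOn ℂ G (logRegion δ))
    (hb : ∀ p ∈ logRegion δ, ‖G p‖ ≤ C * rhoWeight (Real.exp p.1.re))
    {v : ℂ × ℂ} (hv : ‖v‖ ≤ 1) {p : ℂ × ℂ} (hp : p ∈ logRegion (δ / 4)) :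
    ‖fderiv ℂ G p v‖ ≤ (486 * C / (δ / 4)) * rhoWeight (Real.exp p.1.re) := by
  have hsub := ball_subset_logRegion hp
  have hq : ∀ q ∈ Metric.ball p (δ / 4),
      ‖G q‖ ≤ C * (243 * rhoWeight (Real.exp p.1.re)) := by
    intro q hq
    refine (hb q (hsub hq)).trans (mul_le_mul_of_nonneg_left ?_ hC.le)
    refine rhoWeight_le_of_le_three_mul (Real.exp_pos _) ?_
    rw [mem_ball_iff_norm, Prod.norm_def, max_lt_iff] at hq
    have a1 := abs_lt.1 ((abs_re_le_norm (q - p).1).trans_lt hq.1)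
    simp only [Prod.fst_sub, sub_re] at a1
    have e : Real.exp p.1.re = Real.exp (p.1.re - q.1.re) * Real.exp q.1.re := by
      rw [← Real.exp_add]; congr 1; ring
    rw [e]
    refine mul_le_mul_of_nonneg_right ?_ (Real.exp_pos _).le
    have h1 : Real.exp (p.1.re - q.1.re) ≤ Real.exp 1 := Real.exp_le_exp.2 (by linarith)
    linarith [Real.exp_one_lt_d9]
  have h := Complex.norm_fderiv_le_div_of_mapsTo_ball (hG.mono hsub)
    (R₂ := 486 * C * rhoWeight (Real.exp p.1.re)) (by
      intro z hz
      rw [mem_closedBall_iff_norm]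
      have h1 := hq z hz
      have h2 := hq p (Metric.mem_ball_self (by positivity))
      linarith [norm_sub_le (G z) (G p)]) (by positivity)
  calc ‖fderiv ℂ G p v‖ ≤ ‖fderiv ℂ G p‖ * ‖v‖ := ContinuousLinearMap.le_opNorm _ _
    _ ≤ ‖fderiv ℂ G p‖ * 1 := by gcongr
    _ ≤ _ := by rw [mul_one]; refine h.trans (le_of_eq ?_); ring

lemma IsLogSymbol.apply_DU {R : ℝ → ℝ → ℂ} (hR : IsLogSymbol R) : IsLogSymbol (DU R) := by
  obtain ⟨δ, C, G, hδ, hδ1, hC, hG, hb, hRG⟩ := hR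
  refine ⟨δ / 4, 486 * C / (δ / 4), dFst G, by positivity, by linarith, by positivity,
    differentiableOn_dFst (isOpen_logRegion _) (hG.mono (logRegion_mono (by linarith))),
    fun p hp => norm_fderiv_apply_le_of_logRegion hδ hδ1 hC hG hb (by simp [Prod.norm_def]) hp,
    fun u ξ hu hξ h => ?_⟩
  have hlog := (Real.hasDerivAt_log hu.ne').ofReal_comp
  have e : ((0 : ℂ), (Real.log ξ : ℂ)) + (Real.log u : ℂ) • ((1 : ℂ), (0 : ℂ))
      = ((Real.log u : ℂ), (Real.log ξ : ℂ)) := by simp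
  have hd : DifferentiableAt ℂ G
      (((0 : ℂ), (Real.log ξ : ℂ)) + (Real.log u : ℂ) • ((1 : ℂ), (0 : ℂ))) := by
    rw [e]
    exact hG.differentiableAt ((isOpen_logRegion δ).mem_nhds
      (ofReal_mem_logRegion hδ (by linarith)))
  have h1 := (hasDerivAt_line hd).comp u hlog
  rw [e] at h1
  have hne : ∀ᶠ v in 𝓝 u, R v ξ =
      G (((0 : ℂ), (Real.log ξ : ℂ)) + (Real.log v : ℂ) • ((1 : ℂ), (0 : ℂ))) := by
    have hcont : ContinuousAt (fun v => Real.log v + δ) u :=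
      (Real.continuousAt_log hu.ne').add continuousAt_const
    filter_upwards [Ioi_mem_nhds hu, hcont.eventually (lt_mem_nhds
      (show Real.log ξ < Real.log u + δ by linarith))] with v hv hv'
    rw [hRG v ξ hv hξ hv']
    simp
  have h2 : HasDerivAt (fun v => R v ξ) _ u := h1.congr_of_eventuallyEq hne
  have hu' : (u : ℂ) ≠ 0 := ofReal_ne_zero.2 hu.ne'
  rw [DU, h2.deriv, dFst]
  push_cast
  field_simp

lemma IsLogSymbol.apply_DXI {R : ℝ → ℝ → ℂ} (hR : IsLogSymbol R) : IsLogSymbol (DXI R) := by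
  obtain ⟨δ, C, G, hδ, hδ1, hC, hG, hb, hRG⟩ := hR
  refine ⟨δ / 4, 486 * C / (δ / 4), dSnd G, by positivity, by linarith, by positivity,
    differentiableOn_dSnd (isOpen_logRegion _) (hG.mono (logRegion_mono (by linarith))),
    fun p hp => norm_fderiv_apply_le_of_logRegion hδ hδ1 hC hG hb (by simp [Prod.norm_def]) hp,
    fun u ξ hu hξ h => ?_⟩
  have hlog := (Real.hasDerivAt_log hξ.ne').ofReal_comp
  have e : ((Real.log u : ℂ), (0 : ℂ)) + (Real.log ξ : ℂ) • ((0 : ℂ), (1 : ℂ))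
      = ((Real.log u : ℂ), (Real.log ξ : ℂ)) := by simp
  have hd : DifferentiableAt ℂ G
      (((Real.log u : ℂ), (0 : ℂ)) + (Real.log ξ : ℂ) • ((0 : ℂ), (1 : ℂ))) := by
    rw [e]
    exact hG.differentiableAt ((isOpen_logRegion δ).mem_nhds
      (ofReal_mem_logRegion hδ (by linarith)))
  have h1 := (hasDerivAt_line hd).comp ξ hlog
  rw [e] at h1
  have hne : ∀ᶠ η in 𝓝 ξ, R u η =
      G (((Real.log u : ℂ), (0 : ℂ)) + (Real.log η : ℂ) • ((0 : ℂ), (1 : ℂ))) := by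
    filter_upwards [Ioi_mem_nhds hξ, (Real.continuousAt_log hξ.ne').eventually (gt_mem_nhds
      (show Real.log ξ < Real.log u + δ by linarith))] with η hη hη'
    rw [hRG u η hu hη hη']
    simp
  have h2 : HasDerivAt (fun η => R u η) _ ξ := h1.congr_of_eventuallyEq hne
  have hξ' : (ξ : ℂ) ≠ 0 := ofReal_ne_zero.2 hξ.ne'
  rw [DXI, h2.deriv, dSnd]
  push_cast
  field_simp

lemma IsLogSymbol.iterate {R : ℝ → ℝ → ℂ} (hR : IsLogSymbol R) (a b : ℕ) :
    IsLogSymbol (DU^[a] (DXI^[b] R)) := by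
  have hb : IsLogSymbol (DXI^[b] R) := by
    induction b with
    | zero => exact hR
    | succ b ih => rw [Function.iterate_succ_apply']; exact ih.apply_DXI
  induction a with
  | zero => exact hb
  | succ a ih => rw [Function.iterate_succ_apply']; exact ih.apply_DU

lemma IsLogSymbol.exists_bound {R : ℝ → ℝ → ℂ} (hR : IsLogSymbol R) :
    ∃ C, 0 < C ∧ ∀ u ξ : ℝ, 0 < ξ → ξ ≤ u → ‖R u ξ‖ ≤ C * rhoWeight u := by
  obtain ⟨δ, C, G, hδ, -, hC, -, hb, hRG⟩ := hR
  refine ⟨C, hC, fun u ξ hξ hu => ?_⟩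
  have h0 : 0 < u := hξ.trans_le hu
  have hlt : Real.log ξ < Real.log u + δ := by linarith [Real.log_le_log hξ hu]
  rw [hRG u ξ h0 hξ hlt]
  have h := hb _ (ofReal_mem_logRegion hδ hlt)
  rwa [ofReal_re, Real.exp_log h0] at h

lemma exp_re_bounds {s : ℂ} (hs : |s.im| < 1 / 8) :
    |(Complex.exp s).im| ≤ (Complex.exp s).re / 4 ∧
      9 / 10 * Real.exp s.re ≤ (Complex.exp s).re := by
  rw [Complex.exp_re, Complex.exp_im, abs_mul, abs_of_pos (Real.exp_pos _)]
  have h1 := Real.abs_sin_le_abs (x := s.im)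
  have h2 := Real.one_sub_sq_div_two_le_cos (x := s.im)
  have h3 : s.im ^ 2 ≤ (1 / 8) ^ 2 := sq_le_sq' (abs_lt.1 hs).1.le (abs_lt.1 hs).2.le
  have h4 := Real.exp_pos s.re
  constructor
  · have : |Real.sin s.im| ≤ Real.cos s.im / 4 := by norm_num at h3; linarith
    nlinarith
  · have : 9 / 10 ≤ Real.cos s.im := by norm_num at h3; linarith
    nlinarith

lemma exp_mem_jostDomain {p : ℂ × ℂ} (hp : p ∈ logRegion (1 / 8)) :
    (Complex.exp p.1, Complex.exp p.2 ^ 2) ∈ jostDomain := by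
  obtain ⟨h1, h2, h3⟩ := hp
  obtain ⟨a1, a2⟩ := exp_re_bounds h1
  obtain ⟨b1, b2⟩ := exp_re_bounds h2
  have e1 := Real.exp_pos p.1.re
  have e2 := Real.exp_pos p.2.re
  have e3 : Real.exp p.2.re ≤ Real.exp (1 / 8) * Real.exp p.1.re := by
    rw [← Real.exp_add]; exact Real.exp_le_exp.2 (by linarith)
  have e4 : Real.exp (1 / 8) ^ 2 ≤ 3 := by
    rw [← Real.exp_nat_mul]
    have : Real.exp (((2 : ℕ) : ℝ) * (1 / 8)) ≤ Real.exp 1 := Real.exp_le_exp.2 (by norm_num)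
    linarith [Real.exp_one_lt_d9]
  refine ⟨?_, ?_, ?_⟩
  · simp only; linarith
  · simp only [pow_two, mul_re]
    have : (Complex.exp p.2).im * (Complex.exp p.2).im ≤
        ((Complex.exp p.2).re / 4) * ((Complex.exp p.2).re / 4) := by
      rw [← abs_mul_abs_self]
      have : 0 ≤ (Complex.exp p.2).re / 4 := by linarith
      gcongr
    nlinarith
  · simp only [norm_pow, Complex.norm_exp]
    calc Real.exp p.2.re ^ 2 ≤ (Real.exp (1 / 8) * Real.exp p.1.re) ^ 2 := by gcongr
      _ = Real.exp (1 / 8) ^ 2 * Real.exp p.1.re ^ 2 := mul_pow _ _ _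
      _ ≤ 3 * Real.exp p.1.re ^ 2 := by gcongr
      _ < 4 * (9 / 10 * Real.exp p.1.re) ^ 2 := by nlinarith
      _ ≤ _ := by gcongr

/-- The correction `ρ₁`. -/
def rhoOne (u ξ : ℝ) : ℂ := rhoHol ((u : ℂ), (ξ : ℂ) ^ 2)

lemma isLogSymbol_rhoOne : IsLogSymbol rhoOne := by
  obtain ⟨c, hc, hbound⟩ := exists_norm_rhoHol_le
  refine ⟨1 / 8, c * 243, fun p => rhoHol (Complex.exp p.1, Complex.exp p.2 ^ 2), by norm_num,
    by norm_num, by positivity, ?_, fun p hp => ?_, fun u ξ hu hξ _ => ?_⟩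
  · exact differentiableOn_rhoHol.comp (by fun_prop) fun p hp => exp_mem_jostDomain hp
  · refine (hbound _ (exp_mem_jostDomain hp)).1.trans ?_
    rw [mul_assoc]
    refine mul_le_mul_of_nonneg_left ?_ hc.le
    refine rhoWeight_le_of_le_three_mul (Real.exp_pos _) ?_
    have := (exp_re_bounds hp.1).2
    have := Real.exp_pos p.1.re
    simp only
    linarith
  · simp only [rhoOne, ← ofReal_exp, Real.exp_log hu, Real.exp_log hξ]

lemma contDiffOn_rhoOne : ContDiffOn ℝ (⊤ : ℕ∞) (fun p : ℝ × ℝ => rhoOne p.1 p.2)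
    {p : ℝ × ℝ | 0 < p.2 ∧ p.2 ≤ 1 ∧ p.2 ≤ p.1} := by
  refine contDiffOn_infty.2 fun n => ?_
  have h := (contDiffOn_nat_of_differentiableOn isOpen_jostDomain
    differentiableOn_rhoHol n).restrict_scalars ℝ
  refine h.comp (f := fun p : ℝ × ℝ => ((p.1 : ℂ), (p.2 : ℂ) ^ 2)) ?_ ?_
  · have h1 : ContDiff ℝ n (fun x : ℝ => (x : ℂ)) := ofRealCLM.contDiff
    exact ((h1.comp contDiff_fst).prodMk ((h1.comp contDiff_snd).pow 2)).contDiffOn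
  · rintro p ⟨h1, -, h3⟩
    exact mem_jostDomain_of_half_lt h1 (by linarith)

/-! ### The Jost solution representation -/

/-- The Jost solution in the original variable. -/
def jostSolution (ξ x : ℝ) : ℂ := hplus (x * ξ) * (1 + (ξ : ℂ) ^ 2 * rhoOne (x * ξ) ξ)

lemma jostSolution_eq {ξ x : ℝ} (hξ : 0 < ξ) (hx : 1 / 2 < x) :
    jostSolution ξ x = jostFun ξ (x * ξ) := by
  rw [jostSolution, jostFun, jostQuotient_eq (mem_jostDomain_of_half_lt hξ (by nlinarith)), rhoOne]

lemma hasDerivAt_jostSolution {ξ x : ℝ} (hξ : 0 < ξ) (hx : 1 / 2 < x) :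
    HasDerivAt (jostSolution ξ) (ξ * jostFunDeriv ξ (x * ξ)) x := by
  have h := (hasDerivAt_jostFun hξ (u := x * ξ) (by nlinarith)).scomp x
    (hasDerivAt_mul_const (x := x) ξ)
  rw [real_smul] at h
  refine h.congr_of_eventuallyEq ?_
  filter_upwards [Ioi_mem_nhds hx] with y hy using jostSolution_eq hξ hy

lemma jostSolution_ode {ξ x : ℝ} (hξ : 0 < ξ) (hx : 1 ≤ x) :
    -deriv (deriv (jostSolution ξ)) x + ((2 / (1 + x ^ 2) : ℝ) : ℂ) * jostSolution ξ x
      = (ξ : ℂ) ^ 2 * jostSolution ξ x := by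
  have hx' : 1 / 2 < x := by linarith
  have h := ((hasDerivAt_jostFunDeriv hξ (u := x * ξ) (by nlinarith)).scomp x
    (hasDerivAt_mul_const (x := x) ξ)).const_mul (ξ : ℂ)
  have h2 : HasDerivAt (deriv (jostSolution ξ)) _ x := h.congr_of_eventuallyEq <| by
    filter_upwards [Ioi_mem_nhds hx'] with y hy using (hasDerivAt_jostSolution hξ hy).deriv
  rw [h2.deriv, real_smul, jostSolution_eq hξ hx']
  have h1 : ((1 : ℂ) + (x : ℂ) ^ 2) ≠ 0 := by exact_mod_cast (by positivity : (1 + x ^ 2) ≠ 0)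
  have h3 : (ξ : ℂ) ≠ 0 := ofReal_ne_zero.2 hξ.ne'
  have e : 2 / (((x * ξ : ℝ) : ℂ) ^ 2 + (ξ : ℂ) ^ 2) = 2 / (1 + (x : ℂ) ^ 2) / (ξ : ℂ) ^ 2 := by
    push_cast
    rw [div_div]
    congr 1
    ring
  rw [e]
  push_cast
  field_simp
  ring

lemma tendsto_jostSolution {ξ : ℝ} (hξ : 0 < ξ) :
    Tendsto (fun x : ℝ => Complex.exp (-(Complex.I) * x * ξ) * jostSolution ξ x)
      atTop (𝓝 1) := by
  obtain ⟨c, hc, hbound⟩ := exists_norm_rhoHol_le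
  have hu : Tendsto (fun x : ℝ => x * ξ) atTop atTop := tendsto_id.atTop_mul_const hξ
  have hinv : Tendsto (fun x : ℝ => (x * ξ)⁻¹) atTop (𝓝 0) := tendsto_inv_atTop_zero.comp hu
  have h1 : Tendsto (fun x : ℝ => 1 + Complex.I * (((x * ξ)⁻¹ : ℝ) : ℂ)) atTop (𝓝 1) := by
    have := (((continuous_ofReal.tendsto 0).comp hinv).const_mul Complex.I).const_add 1
    simpa using this
  have h2 : Tendsto (fun x : ℝ => rhoOne (x * ξ) ξ) atTop (𝓝 0) := by
    refine squeeze_zero_norm' (a := fun x => c * ((x * ξ)⁻¹) ^ 2) ?_ ?_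
    · filter_upwards [eventually_gt_atTop (1 / 2)] with x hx
      have h := (hbound _ (mem_jostDomain_of_half_lt hξ (u := x * ξ) (by nlinarith))).2
      rw [rhoOne, inv_pow]
      simpa only [ofReal_re] using h
    · simpa using (hinv.pow 2).const_mul c
  have h3 : Tendsto (fun x : ℝ => 1 + (ξ : ℂ) ^ 2 * rhoOne (x * ξ) ξ) atTop (𝓝 1) := by
    simpa using (h2.const_mul ((ξ : ℂ) ^ 2)).const_add 1
  have h4 := h1.mul h3
  rw [one_mul] at h4
  refine h4.congr fun x => ?_
  rw [jostSolution, hplus, ← mul_assoc, ← mul_assoc, ← Complex.exp_add]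
  have e : -Complex.I * x * ξ + Complex.I * ((x * ξ : ℝ) : ℂ) = 0 := by push_cast; ring
  rw [e, Complex.exp_zero, one_mul, div_eq_mul_inv, ofReal_inv]

/-! ### The expansion in powers of `ξ² / u²` -/

lemma rescaled_mem_jostDomain {s η : ℂ} (hs : |s.im| < 1 / 8) (hη : ‖η‖ < 1 / 8) :
    (Complex.exp s, Complex.exp s ^ 2 * η) ∈ jostDomain := by
  obtain ⟨a1, a2⟩ := exp_re_bounds hs
  have e1 := Real.exp_pos s.re
  have e2 : ‖Complex.exp s ^ 2 * η‖ < Real.exp s.re ^ 2 * (1 / 8) := by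
    rw [norm_mul, norm_pow, Complex.norm_exp]
    gcongr
  have e3 : (9 / 10 * Real.exp s.re) ^ 2 ≤ (Complex.exp s).re ^ 2 := by gcongr
  refine ⟨?_, ?_, ?_⟩
  · simp only; linarith
  · have h := (abs_lt.1 ((abs_re_le_norm _).trans_lt e2)).1
    simp only
    nlinarith
  · simp only; nlinarith

/-- `u² ρ₁` in the variables `s = log u` and `η = ξ² / u²`. -/
def rescaledRho (s η : ℂ) : ℂ :=
  Complex.exp s ^ 2 * rhoHol (Complex.exp s, Complex.exp s ^ 2 * η)

lemma differentiableAt_rescaledRho {q : ℂ × ℂ} (hs : |q.1.im| < 1 / 8) (hη : ‖q.2‖ < 1 / 8) :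
    DifferentiableAt ℂ (fun p : ℂ × ℂ => rescaledRho p.1 p.2) q := by
  have h := differentiableOn_rhoHol.differentiableAt
    (isOpen_jostDomain.mem_nhds (rescaled_mem_jostDomain hs hη))
  have h1 : DifferentiableAt ℂ
      (fun p : ℂ × ℂ => (Complex.exp p.1, Complex.exp p.1 ^ 2 * p.2)) q := by fun_prop
  have h2 := DifferentiableAt.comp q h h1
  have h3 : DifferentiableAt ℂ (fun p : ℂ × ℂ => Complex.exp p.1 ^ 2) q := by fun_prop
  exact h3.mul h2

lemma exists_norm_rescaledRho_le : ∃ M, 0 < M ∧ ∀ s η : ℂ, |s.im| < 1 / 8 → ‖η‖ < 1 / 8 →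
    ‖rescaledRho s η‖ ≤ M := by
  obtain ⟨c, hc, hbound⟩ := exists_norm_rhoHol_le
  refine ⟨2 * c, by positivity, fun s η hs hη => ?_⟩
  have h := (hbound _ (rescaled_mem_jostDomain hs hη)).2
  obtain ⟨-, a2⟩ := exp_re_bounds hs
  have e1 := Real.exp_pos s.re
  have e2 : 0 < (Complex.exp s).re := by linarith
  rw [rescaledRho, norm_mul, norm_pow, Complex.norm_exp]
  calc Real.exp s.re ^ 2 * ‖rhoHol (Complex.exp s, Complex.exp s ^ 2 * η)‖
      ≤ Real.exp s.re ^ 2 * (c * ((Complex.exp s).re ^ 2)⁻¹) := by gcongr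
    _ = c * Real.exp s.re ^ 2 / (Complex.exp s).re ^ 2 := by ring
    _ ≤ 2 * c := by
      rw [div_le_iff₀ (by positivity)]
      have e3 : (9 / 10 * Real.exp s.re) ^ 2 ≤ (Complex.exp s).re ^ 2 := by gcongr
      have e4 : Real.exp s.re ^ 2 ≤ 2 * (Complex.exp s).re ^ 2 := by nlinarith
      nlinarith

/-- The Taylor coefficients of `rescaledRho s`, up to sign. -/
def gammaLog (j : ℕ) (s : ℂ) : ℂ :=
  (-1) ^ j * ((2 * Real.pi * I : ℂ)⁻¹ • ∮ η in C(0, 1 / 16), (η⁻¹) ^ j * (η⁻¹ * rescaledRho s η))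

lemma norm_gammaLog_integrand_le {M : ℝ} (hM : ∀ s η : ℂ, |s.im| < 1 / 8 → ‖η‖ < 1 / 8 →
    ‖rescaledRho s η‖ ≤ M) (j : ℕ) {s η : ℂ} (hs : |s.im| < 1 / 8) (hη : ‖η‖ = 1 / 16) :
    ‖(η⁻¹) ^ j * (η⁻¹ * rescaledRho s η)‖ ≤ 16 * (M * 16 ^ j) := by
  rw [norm_mul, norm_mul, norm_pow, norm_inv, hη]
  have h := hM s η hs (by rw [hη]; norm_num)
  norm_num
  have : (0 : ℝ) < 16 ^ j := by positivity
  nlinarith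

lemma exists_norm_gammaLog_le : ∃ M, 0 < M ∧ ∀ (j : ℕ) (s : ℂ), |s.im| < 1 / 8 →
    ‖gammaLog j s‖ ≤ M * 16 ^ j := by
  obtain ⟨M, hM0, hM⟩ := exists_norm_rescaledRho_le
  refine ⟨M, hM0, fun j s hs => ?_⟩
  rw [gammaLog, norm_mul, norm_pow, norm_neg, norm_one, one_pow, one_mul]
  have h := circleIntegral.norm_two_pi_i_inv_smul_integral_le_of_norm_le_const (c := 0)
    (R := 1 / 16) (C := 16 * (M * 16 ^ j)) (by norm_num)
    (f := fun η => (η⁻¹) ^ j * (η⁻¹ * rescaledRho s η))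
    fun η hη => norm_gammaLog_integrand_le hM j hs (by simpa using hη)
  refine h.trans (le_of_eq ?_)
  ring

lemma isOpen_strip : IsOpen {s : ℂ | |s.im| < 1 / 8} :=
  isOpen_lt continuous_im.abs continuous_const

lemma differentiableOn_gammaLog (j : ℕ) :
    DifferentiableOn ℂ (gammaLog j) {s : ℂ | |s.im| < 1 / 8} := by
  obtain ⟨M, hM0, hM⟩ := exists_norm_rescaledRho_le
  have hcm : ∀ θ, ‖circleMap 0 (1 / 16) θ‖ = 1 / 16 := fun θ => by simp
  have hlt : ∀ θ, ‖circleMap 0 (1 / 16) θ‖ < 1 / 8 := fun θ => by rw [hcm]; norm_num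
  have hne : ∀ θ, circleMap 0 (1 / 16) θ ≠ 0 := fun θ => by
    rw [← norm_pos_iff, hcm]; norm_num
  have hcinv : Continuous fun θ => (circleMap 0 (1 / 16) θ)⁻¹ :=
    (continuous_circleMap 0 (1 / 16)).inv₀ hne
  have hU : IsOpen {p : ℂ × ℂ | |p.1.im| < 1 / 8} := isOpen_strip.preimage continuous_fst
  have key : DifferentiableOn ℂ (fun p : ℂ × ℂ => ∫ θ in Set.Ioc 0 (2 * Real.pi),
      deriv (circleMap 0 (1 / 16)) θ * (((circleMap 0 (1 / 16) θ)⁻¹) ^ j *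
        ((circleMap 0 (1 / 16) θ)⁻¹ * rescaledRho p.1 (circleMap 0 (1 / 16) θ))))
      {p : ℂ × ℂ | |p.1.im| < 1 / 8} := by
    refine differentiableOn_integral_param (bound := fun _ => M * 16 ^ j) hU ?_ ?_ ?_ ?_
    · intro p hp
      refine Continuous.aestronglyMeasurable ?_
      have hr : Continuous fun θ => rescaledRho p.1 (circleMap 0 (1 / 16) θ) := by
        refine continuous_iff_continuousAt.2 fun θ => ?_
        exact ContinuousAt.comp (f := fun θ => (p.1, circleMap 0 (1 / 16) θ))
          (g := fun p : ℂ × ℂ => rescaledRho p.1 p.2)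
          (differentiableAt_rescaledRho (q := (p.1, circleMap 0 (1 / 16) θ)) hp
            (hlt θ)).continuousAt
          (continuousAt_const.prodMk (continuous_circleMap 0 (1 / 16)).continuousAt)
      simp only [deriv_circleMap]
      exact ((continuous_circleMap 0 (1 / 16)).mul continuous_const).mul
        ((hcinv.pow j).mul (hcinv.mul hr))
    · refine Eventually.of_forall fun θ p hp => ?_
      have h := DifferentiableAt.comp (f := fun p : ℂ × ℂ => (p.1, circleMap 0 (1 / 16) θ)) p
        (differentiableAt_rescaledRho (q := (p.1, circleMap 0 (1 / 16) θ)) hp (hlt θ))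
        (by fun_prop)
      exact (((h.const_mul _).const_mul _).const_mul _).differentiableWithinAt
    · refine Eventually.of_forall fun θ p hp => ?_
      have h := norm_gammaLog_integrand_le hM j hp (hcm θ)
      rw [norm_mul, deriv_circleMap, norm_mul, hcm, norm_I]
      linarith
    · exact integrable_const _
  have h := key.comp (f := fun s : ℂ => (s, (0 : ℂ))) (s := {s : ℂ | |s.im| < 1 / 8})
    (by fun_prop) (fun s hs => hs)
  refine ((h.const_mul (2 * Real.pi * I : ℂ)⁻¹).const_mul ((-1) ^ j)).congr fun s _ => ?_
  rw [gammaLog, circleIntegral, intervalIntegral.integral_of_le (by positivity)]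
  rfl

/-- The coefficients of the expansion of `ρ₁`. -/
def gammaCoeff (j : ℕ) (u : ℝ) : ℂ := gammaLog j (Real.log u)

lemma contDiffOn_gammaCoeff (j : ℕ) : ContDiffOn ℝ (⊤ : ℕ∞) (gammaCoeff j) (Set.Ioi 0) := by
  have h := ((differentiableOn_gammaLog j).contDiffOn (n := (⊤ : ℕ∞))
    isOpen_strip).restrict_scalars ℝ
  refine h.comp (f := fun u : ℝ => (Real.log u : ℂ)) ?_ fun u _ => by simp
  exact ofRealCLM.contDiff.comp_contDiffOn
    (Real.contDiffOn_log.mono fun u hu => ne_of_gt (Set.mem_Ioi.1 hu))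

lemma DU1_iterate_comp_log {g : ℂ → ℂ} {S : Set ℂ} (hS : IsOpen S) (hg : DifferentiableOn ℂ g S)
    (hR : ∀ σ : ℝ, (σ : ℂ) ∈ S) (a : ℕ) {u : ℝ} (hu : 0 < u) :
    (DU1^[a] fun v => g (Real.log v)) u = iteratedDeriv a g (Real.log u) := by
  induction a generalizing u with
  | zero => simp
  | succ a ih =>
    rw [Function.iterate_succ_apply', DU1]
    have hd : DifferentiableAt ℂ (iteratedDeriv a g) (Real.log u : ℂ) := by
      rw [iteratedDeriv_eq_iterate]
      exact ((hg.analyticAt (hS.mem_nhds (hR _))).iterated_deriv a).differentiableAt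
    have h1 := hd.hasDerivAt.comp u (Real.hasDerivAt_log hu.ne').ofReal_comp
    have h2 : HasDerivAt (DU1^[a] fun v => g (Real.log v)) _ u := h1.congr_of_eventuallyEq <| by
      filter_upwards [Ioi_mem_nhds hu] with v hv using ih hv
    have hu' : (u : ℂ) ≠ 0 := ofReal_ne_zero.2 hu.ne'
    rw [h2.deriv, iteratedDeriv_succ]
    push_cast
    field_simp

lemma exists_norm_DU1_gammaCoeff_le : ∃ M, 0 < M ∧ ∀ (j a : ℕ) (u : ℝ), 0 < u →
    ‖(DU1^[a] (gammaCoeff j)) u‖ ≤ (a.factorial * M * 16 ^ a) * 16 ^ j := by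
  obtain ⟨M, hM0, hM⟩ := exists_norm_gammaLog_le
  refine ⟨M, hM0, fun j a u hu => ?_⟩
  have h := DU1_iterate_comp_log isOpen_strip (differentiableOn_gammaLog j)
    (fun σ => by simp) a hu
  change (DU1^[a] (gammaCoeff j)) u = _ at h
  rw [h]
  have hsub : Metric.closedBall (Real.log u : ℂ) (1 / 16) ⊆ {s : ℂ | |s.im| < 1 / 8} := by
    intro z hz
    rw [mem_closedBall_iff_norm] at hz
    have := (abs_im_le_norm _).trans hz
    rw [sub_im, ofReal_im, sub_zero] at this
    exact this.trans_lt (by norm_num)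
  have hd : DiffContOnCl ℂ (gammaLog j) (Metric.ball (Real.log u : ℂ) (1 / 16)) :=
    (((differentiableOn_gammaLog j).mono hsub).mono Metric.closure_ball_subset_closedBall).diffContOnCl
  have hle := Complex.norm_iteratedDeriv_le_of_forall_mem_sphere_norm_le a (by norm_num) hd
    (fun z hz => hM j z (hsub (Metric.sphere_subset_closedBall hz)))
  refine hle.trans (le_of_eq ?_)
  rw [one_div, inv_pow, div_inv_eq_mul]
  ring

lemma hasSum_rescaledRho {s η : ℂ} (hs : |s.im| < 1 / 8) (hη : ‖η‖ < 1 / 16) :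
    HasSum (fun j : ℕ => (-1) ^ j * gammaLog j s * η ^ j) (rescaledRho s η) := by
  have hd : DifferentiableOn ℂ (rescaledRho s) (Metric.closedBall 0 ((1 / 16 : NNReal) : ℝ)) := by
    intro z hz
    have hz' : ‖z‖ < 1 / 8 := by
      rw [mem_closedBall_zero_iff] at hz
      refine hz.trans_lt ?_
      push_cast
      norm_num
    exact (DifferentiableAt.comp (f := fun z : ℂ => (s, z)) z
      (differentiableAt_rescaledRho (q := (s, z)) hs hz') (by fun_prop)).differentiableWithinAt
  have h := (hd.hasFPowerSeriesOnBall (by positivity)).hasSum (y := η) (by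
    rw [mem_eball_zero_iff, ← ofReal_norm, ENNReal.ofReal_lt_coe_iff (norm_nonneg _)]
    simpa using hη)
  rw [zero_add] at h
  refine h.congr_fun fun j => ?_
  have h1 : ((-1 : ℂ) ^ j) * (-1) ^ j = 1 := by rw [← mul_pow]; simp
  simp only [cauchyPowerSeries, gammaLog, ContinuousMultilinearMap.mkPiRing_apply, Fin.prod_const,
    sub_zero, smul_eq_mul]
  push_cast
  rw [← mul_assoc ((-1 : ℂ) ^ j), h1]
  ring

lemma hasSum_rhoOne {ξ u : ℝ} (hξ : 0 < ξ) (hu : 8 * ξ ≤ u) :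
    HasSum (fun j : ℕ => (-1 : ℂ) ^ j * (u : ℂ) ^ (-(2 : ℤ) - 2 * (j : ℤ)) * gammaCoeff j u *
      (ξ : ℂ) ^ (2 * j)) (rhoOne u ξ) := by
  have hu0 : 0 < u := by linarith
  have hu' : (u : ℂ) ≠ 0 := ofReal_ne_zero.2 hu0.ne'
  have hη : ‖((ξ : ℂ) / u) ^ 2‖ < 1 / 16 := by
    rw [norm_pow, norm_div, norm_real, norm_real, Real.norm_of_nonneg hξ.le,
      Real.norm_of_nonneg hu0.le]
    have : ξ / u ≤ 1 / 8 := by rw [div_le_iff₀ hu0]; linarith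
    calc (ξ / u) ^ 2 ≤ (1 / 8) ^ 2 := by gcongr
      _ < 1 / 16 := by norm_num
  have h := (hasSum_rescaledRho (s := (Real.log u : ℂ)) (by simp) hη).mul_left (((u : ℂ) ^ 2)⁻¹)
  have e : Complex.exp (Real.log u : ℂ) = u := by rw [← ofReal_exp, Real.exp_log hu0]
  have e1 : (u : ℂ) ^ 2 * ((ξ : ℂ) / u) ^ 2 = (ξ : ℂ) ^ 2 := by field_simp
  rw [rescaledRho, e, e1, inv_mul_cancel_left₀ (pow_ne_zero 2 hu')] at h
  refine h.congr_fun fun j => ?_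
  have e2 : (u : ℂ) ^ (-(2 : ℤ) - 2 * (j : ℤ)) = ((u : ℂ) ^ (2 + 2 * j))⁻¹ := by
    rw [← zpow_natCast, ← zpow_neg]
    congr 1
    push_cast
    ring
  rw [e2, gammaCoeff, ← pow_mul, div_pow, pow_add]
  field_simp

/-- the correction `ρ₁` in the Jost solution expansion can be chosen to
admit an absolutely convergent expansion `ρ₁(u,ξ) = Σ_j (−1)^j u^{−2−2j} γ_j(u) ξ^{2j}`,
with symbol bounds `|(u∂_u)^a γ_j(u)| ≤ C_a C^{2j} (1+j)^a`. -/
theorem rho1_expansion :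
    ∃ (Cab : ℕ → ℕ → ℝ) (ρ₁ : ℝ → ℝ → ℂ),
      (∀ a b : ℕ, 0 < Cab a b) ∧
      ContDiffOn ℝ (⊤ : ℕ∞) (fun p : ℝ × ℝ => ρ₁ p.1 p.2)
        {p : ℝ × ℝ | 0 < p.2 ∧ p.2 ≤ 1 ∧ p.2 ≤ p.1} ∧
      -- symbol-type bounds for ρ₁
      (∀ a b : ℕ, ∀ u ξ : ℝ, 0 < ξ → ξ ≤ 1 → ξ ≤ u →
        ‖(DU^[a] (DXI^[b] ρ₁)) u ξ‖ ≤ Cab a b * (1 + (u⁻¹) ^ 2) * ((1 + u)⁻¹) ^ 3) ∧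
      -- Jost solution representation
      (∀ ξ : ℝ, 0 < ξ → ξ ≤ 1 →
        (∀ x : ℝ, 1 ≤ x →
          - deriv (deriv (fun y : ℝ => hplus (y * ξ) * (1 + (ξ : ℂ) ^ 2 * ρ₁ (y * ξ) ξ))) x
            + ((2 / (1 + x ^ 2) : ℝ) : ℂ) * (hplus (x * ξ) * (1 + (ξ : ℂ) ^ 2 * ρ₁ (x * ξ) ξ))
          = ((ξ : ℂ)) ^ 2 * (hplus (x * ξ) * (1 + (ξ : ℂ) ^ 2 * ρ₁ (x * ξ) ξ))) ∧
        Tendsto (fun x : ℝ =>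
            Complex.exp (-(Complex.I) * x * ξ) *
              (hplus (x * ξ) * (1 + (ξ : ℂ) ^ 2 * ρ₁ (x * ξ) ξ)))
          atTop (nhds 1)) ∧
      -- the expansion
      (∃ C : ℝ, 0 < C ∧ ∃ Ca : ℕ → ℝ, (∀ a, 0 < Ca a) ∧
        ∃ γ : ℕ → ℝ → ℂ,
          (∀ j : ℕ, ContDiffOn ℝ (⊤ : ℕ∞) (γ j) (Set.Ioi (0 : ℝ))) ∧
          (∀ j a : ℕ, ∀ u : ℝ, 0 < u →
            ‖(DU1^[a] (γ j)) u‖ ≤ Ca a * C ^ (2 * j) * ((1 : ℝ) + j) ^ a) ∧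
          (∀ ξ : ℝ, 0 < ξ → ξ ≤ 1 → ∀ u : ℝ, 2 * C * ξ ≤ u →
            Summable (fun j : ℕ =>
              ‖((-1 : ℂ)) ^ j * ((u : ℂ)) ^ (-(2 : ℤ) - 2 * (j : ℤ)) * γ j u * ((ξ : ℂ)) ^ (2 * j)‖) ∧
            ρ₁ u ξ = ∑' j : ℕ,
              ((-1 : ℂ)) ^ j * ((u : ℂ)) ^ (-(2 : ℤ) - 2 * (j : ℤ)) * γ j u * ((ξ : ℂ)) ^ (2 * j))) := by
  choose Cab hpos hCab using fun a b => (isLogSymbol_rhoOne.iterate a b).exists_bound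
  obtain ⟨M, hM0, hM⟩ := exists_norm_DU1_gammaCoeff_le
  refine ⟨Cab, rhoOne, hpos, contDiffOn_rhoOne, fun a b u ξ hξ _ hu => ?_, fun ξ hξ _ =>
    ⟨fun x hx => jostSolution_ode hξ hx, tendsto_jostSolution hξ⟩, 4, by norm_num,
    fun a => a.factorial * M * 16 ^ a, fun a => by positivity, gammaCoeff,
    contDiffOn_gammaCoeff, fun j a u hu => ?_, fun ξ hξ _ u hu => ?_⟩
  · rw [mul_assoc]
    exact hCab a b u ξ hξ hu
  · refine (hM j a u hu).trans ?_
    rw [pow_mul, show (4 : ℝ) ^ 2 = 16 by norm_num]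
    exact le_mul_of_one_le_right (by positivity) (one_le_pow₀ (by simp))
  · have h := hasSum_rhoOne hξ (by linarith : 8 * ξ ≤ u)
    exact ⟨h.summable.norm, h.tsum_eq.symm⟩
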